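/- arXiv:1903.10585 — 3 statements merged into one kernel-verified Lean document; each statement's English description precedes it below -/
import Mathlib

section
/- Let p be a prime and let R be a commutative ring of characteristic p in which f is a nonzerodivisor. Suppose φ: R → R is a Frobenius splitting of R that is compatible with the ideal (f), i.e. φ(fR) ⊆ fR. Then R splits relative to f^{p−1}: there exists a p^{-1}-linear map ψ: R → R with ψ(f^{p−1}) = 1. Explicitly, one may take ψ to be the unique additive map satisfying f·ψ(b) = φ(f·b) for all b ∈ R. -/
/-- Let `p` be a prime and `R` a commutative ring of characteristic `p`
in which `f` is a nonzerodivisor.  If `φ : R → R` is a Frobenius splitting of `R`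
(an additive, `p⁻¹`-linear map with `φ 1 = 1`) that is compatible with the ideal `(f)`,
then `R` splits relative to `f ^ (p - 1)`: there is a `p⁻¹`-linear map `ψ : R → R` with
`ψ (f ^ (p - 1)) = 1`; explicitly one may take `ψ` to be the unique additive map
satisfying `f * ψ b = φ (f * b)` for all `b`. -/
theorem frobenius_split_compatible_implies_relative_split
    (p : ℕ) (hp : p.Prime) (R : Type*) [CommRing R] [CharP R p]
    (f : R) (hf : f ∈ nonZeroDivisors R)
    (φ : R → R)
    (hφ_add : ∀ a b : R, φ (a + b) = φ a + φ b)
    (hφ_lin : ∀ a b : R, φ (a ^ p * b) = a * φ b)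
    (hφ_one : φ 1 = 1)
    (hφ_comp : ∀ b : R, ∃ c : R, φ (f * b) = f * c) :
    ∃ ψ : R → R,
      (∀ a b : R, ψ (a + b) = ψ a + ψ b) ∧
      (∀ a b : R, ψ (a ^ p * b) = a * ψ b) ∧
      ψ (f ^ (p - 1)) = 1 ∧
      (∀ b : R, f * ψ b = φ (f * b)) := by
  choose ψ hψ using hφ_comp
  have key : ∀ x y : R, f * x = f * y → x = y := fun x y h =>
    (mul_cancel_left_mem_nonZeroDivisors hf).1 h
  refine ⟨ψ, fun a b => key _ _ ?_, fun a b => key _ _ ?_, key _ _ ?_, fun b => (hψ b).symm⟩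
  · rw [← hψ, mul_add, hφ_add, hψ, hψ, mul_add]
  · rw [← hψ, mul_left_comm, hφ_lin, hψ, mul_left_comm]
  · rw [← hψ, mul_pow_sub_one hp.ne_zero]
    have h := hφ_lin f 1
    rwa [hφ_one, mul_one] at h
end

section
/- Let p be a prime, let (R, m) be a Noetherian local ring of characteristic p, let f ∈ R, and let i ≥ 0 be an integer. Suppose that R splits relative to f, i.e. there exists a p^{-1}-linear map θ: R → R with θ(f) = 1, and suppose that there exists an integer N ≥ 1 with f^N · H^i_m(R) = 0. Then H^i_m(R) = 0. -/
universe u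

open CategoryTheory CategoryTheory.Abelian CategoryTheory.Limits

namespace LCV

/-- Every element is killed by a power of `I`. -/
def Tors {R : Type u} [CommRing R] (I : Ideal R) (M : Type u) [AddCommGroup M] [Module R M] : Prop :=
  ∀ x : M, ∃ k : ℕ, ∀ r ∈ I ^ k, r • x = 0

/-- The `I`-power torsion submodule. -/
def gam {R : Type u} [CommRing R] (I : Ideal R) (M : Type u) [AddCommGroup M] [Module R M] :
    Submodule R M where
  carrier := {x | ∃ k : ℕ, ∀ r ∈ I ^ k, r • x = 0}
  add_mem' := by
    rintro a b ⟨k, hk⟩ ⟨l, hl⟩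
    refine ⟨k + l, fun r hr => ?_⟩
    rw [smul_add, hk r (Ideal.pow_le_pow_right (by omega) hr),
      hl r (Ideal.pow_le_pow_right (by omega) hr), add_zero]
  zero_mem' := ⟨0, by simp⟩
  smul_mem' := by
    rintro c x ⟨k, hk⟩
    exact ⟨k, fun r hr => by rw [smul_comm, hk r hr, smul_zero]⟩

theorem gam_tors {R : Type u} [CommRing R] (I : Ideal R) (M : Type u) [AddCommGroup M]
    [Module R M] : Tors I (gam I M) := by
  rintro ⟨x, k, hk⟩
  exact ⟨k, fun r hr => Subtype.ext (hk r hr)⟩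

/-- A common power killing all values of a map from a f.g. module. -/
theorem exists_pow_kill {R : Type u} [CommRing R] (I : Ideal R) (M : Type u) [AddCommGroup M]
    [Module R M] (h : Tors I M) (N : Submodule R M) (hN : N.FG) :
    ∃ k : ℕ, ∀ r ∈ I ^ k, ∀ x ∈ N, r • x = 0 := by
  induction N, hN using Submodule.fg_induction with
  | singleton x =>
    obtain ⟨k, hk⟩ := h x
    refine ⟨k, fun r hr y hy => ?_⟩
    obtain ⟨a, rfl⟩ := Submodule.mem_span_singleton.1 hy
    rw [smul_comm, hk r hr, smul_zero]
  | sup A B _ _ hA hB =>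
    obtain ⟨k, hk⟩ := hA
    obtain ⟨l, hl⟩ := hB
    refine ⟨k + l, fun r hr y hy => ?_⟩
    obtain ⟨a, ha, b, hb, rfl⟩ := Submodule.mem_sup.1 hy
    rw [smul_add, hk r (Ideal.pow_le_pow_right (by omega) hr) a ha,
      hl r (Ideal.pow_le_pow_right (by omega) hr) b hb, add_zero]

theorem gam_injective {R : Type u} [CommRing R] [IsNoetherianRing R] (I : Ideal R)
    (M : Type u) [AddCommGroup M] [Module R M] (hM : Module.Injective R M) :
    Module.Injective R (gam I M) := by
  apply Module.Baer.injective
  intro a g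
  obtain ⟨k, hk⟩ := exists_pow_kill I _ (gam_tors I M) (LinearMap.range g)
    (by rw [LinearMap.range_eq_map]; exact Submodule.FG.map g (IsNoetherian.noetherian ⊤))
  obtain ⟨c, hc⟩ := Ideal.exists_pow_inf_eq_pow_smul I (N := a) (M := R)
  have h1 : ∀ x (hx : x ∈ a), x ∈ I ^ (k + c) → g ⟨x, hx⟩ = 0 := by
    intro x hx hxI
    have h2 := hc (k + c) (by omega)
    have h3 : x ∈ (I ^ (k + c) • ⊤ ⊓ a : Submodule R R) := ⟨by simpa using hxI, hx⟩
    rw [h2, Nat.add_sub_cancel] at h3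
    have h4 : x ∈ I ^ k • a := Submodule.smul_mono le_rfl inf_le_right h3
    suffices H : ∀ y ∈ I ^ k • a, ∃ hy : y ∈ a, g ⟨y, hy⟩ = 0 from (H x h4).2
    intro y hy
    refine Submodule.smul_induction_on hy ?_ ?_
    · intro r hr n hn
      refine ⟨a.smul_mem r hn, ?_⟩
      have := hk r hr (g ⟨n, hn⟩) ⟨_, rfl⟩
      rw [← map_smul] at this
      exact this
    · rintro y z ⟨hy, h⟩ ⟨hz, h'⟩
      refine ⟨a.add_mem hy hz, ?_⟩
      have := map_add g ⟨y, hy⟩ ⟨z, hz⟩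
      rw [h, h', add_zero] at this
      exact this
  -- extend to `R ⧸ I^(k+c)`
  let J : Ideal R := I ^ (k + c)
  let q : a →ₗ[R] R ⧸ J := (Submodule.mkQ J).comp a.subtype
  have hker : LinearMap.ker q ≤ LinearMap.ker ((gam I M).subtype ∘ₗ g) := by
    rintro ⟨x, hx⟩ h
    have : x ∈ J := by simpa [q, Ideal.Quotient.eq_zero_iff_mem] using h
    simp [h1 x hx this]
  let e := (LinearMap.quotKerEquivRange q).symm
  let g1 : LinearMap.range q →ₗ[R] M := ((LinearMap.ker q).liftQ ((gam I M).subtype ∘ₗ g) hker) ∘ₗ e.toLinearMap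
  obtain ⟨G, hG⟩ := hM.out (LinearMap.range q).subtype (Submodule.injective_subtype _) g1
  have hmem : ∀ y, G y ∈ gam I M := by
    intro y
    refine ⟨k + c, fun r hr => ?_⟩
    rw [← map_smul]
    obtain ⟨y, rfl⟩ := Submodule.mkQ_surjective _ y
    rw [← map_smul, show (Submodule.mkQ J) (r • y) = 0 from ?_, map_zero]
    exact (Submodule.Quotient.mk_eq_zero J).2 (Ideal.mul_mem_right y _ hr)
  refine ⟨(G.codRestrict _ hmem) ∘ₗ Submodule.mkQ J, fun x hx => Subtype.ext ?_⟩
  have h5 := hG ⟨q ⟨x, hx⟩, ⟨_, rfl⟩⟩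
  have h6 : e ⟨q ⟨x, hx⟩, ⟨_, rfl⟩⟩ = Submodule.Quotient.mk ⟨x, hx⟩ := by
    rw [LinearEquiv.symm_apply_eq]
    rfl
  change G (q ⟨x, hx⟩) = _
  change G (q ⟨x, hx⟩) = ((LinearMap.ker q).liftQ ((gam I M).subtype ∘ₗ g) hker) (e _) at h5
  rw [h5, h6]
  simp

/-! ### Ext part -/

/-- The quotient module. -/
abbrev Q {R : Type u} [CommRing R] (a : Ideal R) : ModuleCat.{u} R := ModuleCat.of R (R ⧸ a)

/-- Transition maps. -/
def tr {R : Type u} [CommRing R] {a b : Ideal R} (h : a ≤ b) : Q a ⟶ Q b :=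
  ModuleCat.ofHom (Submodule.mapQ _ _ LinearMap.id h)

theorem Q_ext {R : Type u} [CommRing R] {a : Ideal R} {M : ModuleCat.{u} R} {u v : Q a ⟶ M}
    (h : u.hom (Submodule.Quotient.mk 1) = v.hom (Submodule.Quotient.mk 1)) : u = v := by
  ext
  exact h

theorem tr_comp {R : Type u} [CommRing R] {a b c : Ideal R} (h : a ≤ b) (h' : b ≤ c) :
    tr h ≫ tr h' = tr (h.trans h') := by
  ext
  simp [tr]

theorem tr_tr {R : Type u} [CommRing R] {a b c : Ideal R} (h : a ≤ b) (h' : b ≤ c)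
    {M : ModuleCat.{u} R} {i : ℕ} (x : Ext (Q c) M i) :
    (Ext.mk₀ (tr h)).comp ((Ext.mk₀ (tr h')).comp x (zero_add i)) (zero_add i) =
      (Ext.mk₀ (tr (h.trans h'))).comp x (zero_add i) := by
  rw [← tr_comp h h', Ext.mk₀_comp_mk₀_assoc]

/-- restriction of a class. -/
noncomputable abbrev res {R : Type u} [CommRing R] {a b : Ideal R} (h : a ≤ b)
    {M : ModuleCat.{u} R} {i : ℕ} (x : Ext (Q b) M i) : Ext (Q a) M i :=
  (Ext.mk₀ (tr h)).comp x (zero_add i)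

theorem exists_tors_ses {R : Type u} [CommRing R] [IsNoetherianRing R] (I : Ideal R)
    (T : ModuleCat.{u} R) (hT : Tors I T) :
    ∃ (G C : ModuleCat.{u} R) (f : T ⟶ G) (g : G ⟶ C) (w : f ≫ g = 0),
      (ShortComplex.mk f g w).ShortExact ∧ Injective G ∧ Tors I G ∧ Tors I C := by
  let E := Injective.under T
  have hE : Module.Injective R E := (Module.injective_iff_injective_object R E).2 (Injective.injective_under T)
  let G : ModuleCat.{u} R := ModuleCat.of R (gam I E)
  have hG : Injective G :=
    (Module.injective_iff_injective_object R G).1 (gam_injective I E hE)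
  let ι : T ⟶ E := Injective.ι T
  have hι : Function.Injective ι.hom := (ModuleCat.mono_iff_injective _).1 inferInstance
  let f : T ⟶ G := ModuleCat.ofHom (ι.hom.codRestrict _ (fun x => by
    obtain ⟨k, hk⟩ := hT x
    exact ⟨k, fun r hr => by rw [← map_smul, hk r hr, map_zero]⟩))
  have hf : Function.Injective f.hom := fun x y h => hι (congrArg Subtype.val h)
  have : Mono f := (ModuleCat.mono_iff_injective _).2 hf
  refine ⟨G, cokernel f, f, cokernel.π f, cokernel.condition f, ?_, hG, gam_tors I E, ?_⟩
  · exact { exact := ShortComplex.exact_cokernel f }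
  · intro y
    obtain ⟨x, rfl⟩ := (ModuleCat.epi_iff_surjective (cokernel.π f)).1 inferInstance y
    obtain ⟨k, hk⟩ := gam_tors I E x
    exact ⟨k, fun r hr => by
      have h2 : r • x = 0 := hk r hr
      rw [← map_smul, h2, map_zero]⟩

theorem lift_tors {R : Type u} [CommRing R] (I : Ideal R) {G C : ModuleCat.{u} R}
    (hG : Tors I G) (g : G ⟶ C) [Epi g] (n : ℕ) (u : Q (I ^ n) ⟶ C) :
    ∃ m, ∃ h : n ≤ m, ∃ v : Q (I ^ m) ⟶ G, v ≫ g = tr (Ideal.pow_le_pow_right h) ≫ u := by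
  obtain ⟨y, hy⟩ := (ModuleCat.epi_iff_surjective g).1 inferInstance (u.hom (Submodule.Quotient.mk 1))
  obtain ⟨k, hk⟩ := hG y
  refine ⟨n + k, by omega, ModuleCat.ofHom (Submodule.liftQ _ (LinearMap.toSpanSingleton R G y) ?_),
    ?_⟩
  · intro r hr
    exact hk r (Ideal.pow_le_pow_right (by omega) hr)
  · apply Q_ext
    change g.hom ((1 : R) • y) = u.hom (Submodule.Quotient.mk 1)
    rw [one_smul]
    exact hy

theorem step1 {R : Type u} [CommRing R] [IsNoetherianRing R] (I : Ideal R) (i : ℕ) :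
    ∀ (T : ModuleCat.{u} R), Tors I T → ∀ (n : ℕ) (x : Ext (Q (I ^ n)) T (i + 1)),
      ∃ m, ∃ h : n ≤ m, res (Ideal.pow_le_pow_right h) x = 0 := by
  induction i with
  | zero =>
    intro T hT n x
    obtain ⟨G, C, f, g, w, hS, hG, hGt, hC⟩ := exists_tors_ses I T hT
    obtain ⟨y, rfl⟩ := Ext.covariant_sequence_exact₁ _ hS x (Ext.eq_zero_of_injective _) rfl
    obtain ⟨u, rfl⟩ := (Ext.mk₀_bijective _ _).2 y
    have : Epi g := hS.epi_g
    obtain ⟨m, h, v, hv⟩ := lift_tors I hGt g n u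
    refine ⟨m, h, ?_⟩
    dsimp only [res]
    rw [Ext.mk₀_comp_mk₀_assoc]
    rw [← hv, ← Ext.mk₀_comp_mk₀_assoc]
    erw [hS.comp_extClass]
    simp
  | succ i ih =>
    intro T hT n x
    obtain ⟨G, C, f, g, w, hS, hG, hGt, hC⟩ := exists_tors_ses I T hT
    obtain ⟨y, rfl⟩ := Ext.covariant_sequence_exact₁ _ hS x (Ext.eq_zero_of_injective _) rfl
    obtain ⟨m, h, hm⟩ := ih C hC n y
    refine ⟨m, h, ?_⟩
    dsimp only [res] at hm ⊢
    rw [← Ext.comp_assoc _ _ _ (zero_add _) rfl (by omega)]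
    erw [hm]
    simp

theorem smul_Q_zero {R : Type u} [CommRing R] {a : Ideal R} {r : R} (hr : r ∈ a)
    {X : ModuleCat.{u} R} (f : X ⟶ Q a) : r • f = 0 := by
  ext x
  change r • (f.hom x) = 0
  obtain ⟨y, hy⟩ := Submodule.Quotient.mk_surjective _ (f.hom x)
  rw [← hy, ← Submodule.Quotient.mk_smul, Submodule.Quotient.mk_eq_zero]
  exact Ideal.mul_mem_right y _ hr

/-- `J` injective over `S`, without elements killed by `a`. -/
theorem step2 {R S : Type u} [CommRing R] [CommRing S] (φ : R →+* S) (a : Ideal R)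
    (J : ModuleCat.{u} S) [Injective J] (hJ : ∀ x : J, (∀ r ∈ a, φ r • x = 0) → x = 0) (i : ℕ)
    (x : Ext (Q a) ((ModuleCat.restrictScalars φ).obj J) (i + 1)) : x = 0 := by
  let P := projectiveResolution (Q a)
  obtain ⟨c, hc, rfl⟩ := P.extMk_surjective x (i + 2) rfl
  rw [P.extMk_eq_zero_iff _ _ _ _ i rfl]
  let adj := ModuleCat.extendRestrictScalarsAdj.{u,u,u} φ
  let F := ModuleCat.extendScalars.{u,u,u} φ
  have : F.Additive := adj.left_adjoint_additive
  let c' : F.obj (P.complex.X (i+1)) ⟶ J := (adj.homEquiv _ _).symm c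
  let d' := F.map (P.complex.d (i+1) i)
  have key : kernel.ι d' ≫ c' = 0 := by
    ext z
    apply hJ
    intro r hr
    have hh : (r • 𝟙 P.complex) ≫ P.π = 0 := by
      rw [Linear.smul_comp, Category.id_comp]
      apply HomologicalComplex.to_single_hom_ext
      rw [HomologicalComplex.smul_f_apply]
      change r • P.π.f 0 = 0
      exact smul_Q_zero hr (P.π.f 0)
    let H := ProjectiveResolution.liftHomotopyZero (P := P) (Q := P) (r • 𝟙 P.complex) hh
    have h1 := H.comm (i+1)
    rw [dNext_eq H.hom (show (ComplexShape.down ℕ).Rel (i+1) i from rfl),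
      prevD_eq H.hom (show (ComplexShape.down ℕ).Rel (i+2) (i+1) from rfl)] at h1
    have h2 : F.map (r • 𝟙 (P.complex.X (i+1))) ≫ c' = c' ≫ (φ r • 𝟙 J) := by
      rw [← adj.homEquiv_naturality_left_symm, ← adj.homEquiv_naturality_right_symm]
      congr 1
      ext y
      simp only [Linear.smul_comp, Category.id_comp]
      rfl
    have h3 : F.map (P.complex.d (i+2) (i+1)) ≫ c' = 0 := by
      rw [← adj.homEquiv_naturality_left_symm, hc]
      apply (adj.homEquiv _ _).injective
      rw [Equiv.apply_symm_apply, adj.homEquiv_unit, Functor.map_zero, comp_zero]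
    have h4 : kernel.ι d' ≫ c' ≫ (φ r • 𝟙 J) = 0 := by
      have h6 : r • 𝟙 (P.complex.X (i+1)) = P.complex.d (i + 1) i ≫ H.hom i (i + 1) +
          H.hom (i + 1) (i + 2) ≫ P.complex.d (i + 2) (i + 1) := by
        simpa using h1
      rw [← h2, h6, F.map_add, F.map_comp, F.map_comp, Preadditive.add_comp, Category.assoc,
        Category.assoc, h3, comp_zero, add_zero, kernel.condition_assoc, zero_comp]
    exact ConcreteCategory.congr_hom h4 z
  let SC := ShortComplex.mk (kernel.ι d') d' (kernel.condition d')
  have hSC : SC.Exact := ShortComplex.exact_kernel d'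
  refine ⟨adj.homEquiv _ _ (hSC.descToInjective c' key), ?_⟩
  rw [← adj.homEquiv_naturality_left]
  erw [hSC.comp_descToInjective c' key]
  simp [c']

noncomputable instance {R S : Type u} [CommRing R] [CommRing S] (φ : R →+* S) :
    PreservesFiniteLimits (ModuleCat.restrictScalars.{u} φ) :=
  have := (ModuleCat.extendRestrictScalarsAdj.{u,u,u} φ).rightAdjoint_preservesLimits.{0, 0}
  inferInstance

noncomputable instance {R S : Type u} [CommRing R] [CommRing S] (φ : R →+* S) :
    PreservesFiniteColimits (ModuleCat.restrictScalars.{u} φ) :=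
  have := (ModuleCat.restrictCoextendScalarsAdj.{u,u,u} φ).leftAdjoint_preservesColimits.{0, 0}
  inferInstance

theorem res_comp_eq_zero {R : Type u} [CommRing R] {a b : Ideal R} (h : a ≤ b)
    {M M' : ModuleCat.{u} R} {i j k : ℕ} (x : Ext (Q b) M i) (w : Ext M M' j) (hw : i + j = k)
    (hx : res h x = 0) : res h (x.comp w hw) = 0 := by
  dsimp only [res] at hx ⊢
  rw [← Ext.comp_assoc _ _ _ (zero_add _) hw (by omega), hx, Ext.zero_comp]

theorem res_res {R : Type u} [CommRing R] {a b c : Ideal R} (h : a ≤ b) (h' : b ≤ c)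
    {M : ModuleCat.{u} R} {i : ℕ} (x : Ext (Q c) M i) :
    res h (res h' x) = res (h.trans h') x := tr_tr h h' x

theorem res_comp {R : Type u} [CommRing R] {a b : Ideal R} (h : a ≤ b)
    {M M' : ModuleCat.{u} R} {i j k : ℕ} (x : Ext (Q b) M i) (w : Ext M M' j) (hw : i + j = k) :
    res h (x.comp w hw) = (res h x).comp w hw :=
  (Ext.comp_assoc _ _ _ (zero_add _) hw (by omega)).symm

theorem step2' {R S : Type u} [CommRing R] [CommRing S] [IsNoetherianRing R] [IsNoetherianRing S]
    (φ : R →+* S) (I : Ideal R) (J : ModuleCat.{u} S) [Injective J] (i n : ℕ)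
    (x : Ext (Q (I ^ n)) ((ModuleCat.restrictScalars φ).obj J) (i + 1)) :
    ∃ m, ∃ h : n ≤ m, res (Ideal.pow_le_pow_right h) x = 0 := by
  have hJ : Module.Injective S J := (Module.injective_iff_injective_object S J).2 inferInstance
  let I' := I.map φ
  let G : ModuleCat.{u} S := ModuleCat.of S (gam I' J)
  have hG : Injective G :=
    (Module.injective_iff_injective_object S G).1 (gam_injective I' J hJ)
  let C : ModuleCat.{u} S := ModuleCat.of S (J ⧸ gam I' J)
  let f : G ⟶ J := ModuleCat.ofHom (gam I' J).subtype
  let g : J ⟶ C := ModuleCat.ofHom (gam I' J).mkQ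
  have hfg : f ≫ g = 0 := by
    ext y
    exact (Submodule.Quotient.mk_eq_zero _).2 y.2
  let SC := ShortComplex.mk f g hfg
  have hS : SC.ShortExact :=
    { exact := by
        rw [ShortComplex.moduleCat_exact_iff]
        intro y hy
        exact ⟨⟨y, (Submodule.Quotient.mk_eq_zero _).1 hy⟩, rfl⟩
      mono_f := (ModuleCat.mono_iff_injective _).2 (Submodule.injective_subtype _)
      epi_g := (ModuleCat.epi_iff_surjective _).2 (Submodule.mkQ_surjective _) }
  have : Injective SC.X₁ := hG
  let sp := hS.splittingOfInjective
  have hC : Injective C := by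
    let rt : Retract C J := { i := sp.s, r := g, retract := sp.s_g }
    exact rt.injective
  have hmap : ∀ (k : ℕ) (M : ModuleCat.{u} S) (y : M), (∀ r ∈ I ^ k, φ r • y = 0) →
      ∀ s ∈ I' ^ k, s • y = 0 := by
    intro k M y hy s hs
    rw [← Ideal.map_pow] at hs
    refine Submodule.span_induction (p := fun s _ => s • y = 0) ?_ ?_ ?_ ?_ hs
    · rintro _ ⟨r, hr, rfl⟩
      exact hy r hr
    · simp
    · intro a b _ _ ha hb
      rw [add_smul, ha, hb, add_zero]
    · intro a b _ hb
      rw [smul_assoc, hb, smul_zero]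
  have h1 : x.comp (Ext.mk₀ ((ModuleCat.restrictScalars φ).map g)) (add_zero _) = 0 := by
    apply step2 φ (I ^ n) C
    intro y hy
    have hy' := hmap n C y hy
    obtain ⟨y, rfl⟩ := Submodule.mkQ_surjective _ y
    refine (Submodule.Quotient.mk_eq_zero _).2 ?_
    have hk : ∀ s ∈ I' ^ n, s • y ∈ gam I' J := fun s hs =>
      (Submodule.Quotient.mk_eq_zero _).1 (hy' s hs)
    have hfg : ((I' ^ n • (Submodule.span S {y})) : Submodule S J).FG :=
      Submodule.FG.smul (IsNoetherian.noetherian _) (Submodule.fg_span_singleton y)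
    have hle : I' ^ n • (Submodule.span S {y}) ≤ gam I' J := by
      rw [Submodule.smul_le]
      intro s hs w hw
      obtain ⟨t, rfl⟩ := Submodule.mem_span_singleton.1 hw
      rw [smul_comm]
      exact (gam I' J).smul_mem _ (hk s hs)
    have hfin : ∃ k : ℕ, ∀ r ∈ I' ^ k, ∀ w ∈ I' ^ n • (Submodule.span S {y}), r • w = 0 := by
      obtain ⟨k, hk⟩ := exists_pow_kill I' _ (gam_tors I' J)
        ((I' ^ n • (Submodule.span S {y})).comap (gam I' J).subtype)
        (by
          apply Submodule.fg_of_fg_map_injective (gam I' J).subtype (Submodule.injective_subtype _)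
          rwa [Submodule.map_comap_subtype, inf_eq_right.2 hle])
      exact ⟨k, fun r hr w hw => congrArg Subtype.val (hk r hr ⟨w, hle hw⟩ hw)⟩
    obtain ⟨k, hk⟩ := hfin
    refine ⟨k + n, fun r hr => ?_⟩
    rw [pow_add] at hr
    refine Submodule.mul_induction_on hr ?_ ?_
    · intro a ha b hb
      rw [mul_smul]
      exact hk a ha _ (Submodule.smul_mem_smul hb (Submodule.mem_span_singleton_self y))
    · intro a b ha hb
      rw [add_smul, ha, hb, add_zero]
  obtain ⟨w, rfl⟩ := Ext.covariant_sequence_exact₂ _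
    (hS.map_of_exact (ModuleCat.restrictScalars φ)) x h1
  have hT : Tors I ((ModuleCat.restrictScalars φ).obj G) := by
    intro y
    obtain ⟨k, hk⟩ := gam_tors I' J y
    refine ⟨k, fun r hr => hk (φ r) ?_⟩
    rw [← Ideal.map_pow]
    exact Ideal.mem_map_of_mem _ hr
  obtain ⟨m, h, hm⟩ := step1 I i _ hT n w
  refine ⟨m, h, ?_⟩
  exact res_comp_eq_zero _ w _ _ hm

/-- The base change map. -/
noncomputable def base {R S : Type u} [CommRing R] [CommRing S] (φ : R →+* S) (a : Ideal R) :
    Q a ⟶ (ModuleCat.restrictScalars φ).obj (Q (a.map φ)) :=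
  ModuleCat.semilinearMapAddEquiv φ (Q a) (Q (a.map φ))
    { toFun := Ideal.quotientMap (a.map φ) φ Ideal.le_comap_map
      map_add' := map_add _
      map_smul' := by
        intro r x
        obtain ⟨x, rfl⟩ := Ideal.Quotient.mk_surjective x
        change Ideal.quotientMap (a.map φ) φ Ideal.le_comap_map (Ideal.Quotient.mk a (r * x)) =
          Ideal.Quotient.mk _ (φ r) * Ideal.quotientMap (a.map φ) φ Ideal.le_comap_map (Ideal.Quotient.mk a x)
        simp }

theorem base_tr {R S : Type u} [CommRing R] [CommRing S] (φ : R →+* S) {a b : Ideal R}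
    (h : a ≤ b) :
    tr h ≫ base φ b = base φ a ≫ (ModuleCat.restrictScalars φ).map (tr (Ideal.map_mono h)) :=
  Q_ext rfl

/-- Comparison of `Ext` over `S` and over `R`. -/
noncomputable def cmp {R S : Type u} [CommRing R] [CommRing S] (φ : R →+* S) (a : Ideal R)
    {M : ModuleCat.{u} S} {i : ℕ} (z : Ext (Q (a.map φ)) M i) :
    Ext (Q a) ((ModuleCat.restrictScalars φ).obj M) i :=
  (Ext.mk₀ (base φ a)).comp (z.mapExactFunctor (ModuleCat.restrictScalars φ)) (zero_add i)

theorem cmp_res {R S : Type u} [CommRing R] [CommRing S] (φ : R →+* S) {a b : Ideal R}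
    (h : a ≤ b) {M : ModuleCat.{u} S} {i : ℕ} (z : Ext (Q (b.map φ)) M i) :
    res h (cmp φ b z) = cmp φ a (res (Ideal.map_mono h) z) := by
  dsimp only [res, cmp]
  rw [Ext.mk₀_comp_mk₀_assoc, base_tr, Ext.mapExactFunctor_comp, Ext.mapExactFunctor_mk₀,
    Ext.mk₀_comp_mk₀_assoc]

theorem cmp_comp {R S : Type u} [CommRing R] [CommRing S] (φ : R →+* S) (a : Ideal R)
    {M M' : ModuleCat.{u} S} {i j k : ℕ} (z : Ext (Q (a.map φ)) M i) (w : Ext M M' j)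
    (h : i + j = k) :
    cmp φ a (z.comp w h) = (cmp φ a z).comp (w.mapExactFunctor (ModuleCat.restrictScalars φ)) h := by
  dsimp only [cmp]
  rw [Ext.mapExactFunctor_comp, Ext.comp_assoc _ _ _ (zero_add _) h (by omega)]

theorem step3 {R S : Type u} [CommRing R] [CommRing S] [IsNoetherianRing R] [IsNoetherianRing S]
    (φ : R →+* S) (I : Ideal R) (i : ℕ) : ∀ (M : ModuleCat.{u} S) (n : ℕ)
    (x : Ext (Q (I ^ n)) ((ModuleCat.restrictScalars φ).obj M) i),
    ∃ m, ∃ h : n ≤ m, ∃ z : Ext (Q ((I ^ m).map φ)) M i,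
      res (Ideal.pow_le_pow_right h) x = cmp φ (I ^ m) z := by
  induction i with
  | zero =>
    intro M n x
    obtain ⟨u, rfl⟩ := (Ext.mk₀_bijective _ _).2 x
    let y : M := u.hom (Submodule.Quotient.mk 1)
    have hy : ∀ r ∈ I ^ n, φ r • y = 0 := by
      intro r hr
      change r • (u.hom (Submodule.Quotient.mk 1)) = 0
      rw [← map_smul, ← Submodule.Quotient.mk_smul,
        (Submodule.Quotient.mk_eq_zero _).2, map_zero]
      simpa using hr
    let v : Q ((I ^ n).map φ) ⟶ M :=
      ModuleCat.ofHom (Submodule.liftQ _ (LinearMap.toSpanSingleton S M y) (by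
        rw [Ideal.map, Ideal.span, Submodule.span_le]
        rintro _ ⟨r, hr, rfl⟩
        exact hy r hr))
    refine ⟨n, le_rfl, Ext.mk₀ v, ?_⟩
    dsimp only [res, cmp]
    rw [Ext.mapExactFunctor_mk₀, Ext.mk₀_comp_mk₀, Ext.mk₀_comp_mk₀]
    congr 1
    apply Q_ext
    change y = v.hom (Ideal.Quotient.mk _ (φ 1))
    rw [map_one]
    exact (one_smul S y).symm
  | succ i ih =>
    intro M n x
    let f := Injective.ι M
    let SC := ShortComplex.mk f (cokernel.π f) (cokernel.condition f)
    have hS : SC.ShortExact := { exact := ShortComplex.exact_cokernel f }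
    have hS' := hS.map_of_exact (ModuleCat.restrictScalars φ)
    obtain ⟨m, h, hm⟩ := step2' φ I (Injective.under M) i n
      (x.comp (Ext.mk₀ ((ModuleCat.restrictScalars φ).map f)) (add_zero _))
    obtain ⟨w, hw⟩ := Ext.covariant_sequence_exact₁ _ hS' (res (Ideal.pow_le_pow_right h) x) (by
      exact (res_comp _ x _ (add_zero _)).symm.trans hm) rfl
    obtain ⟨m', h', z, hz⟩ := ih (cokernel f) m w
    refine ⟨m', h.trans h', z.comp hS.extClass rfl, ?_⟩
    rw [cmp_comp, Ext.mapExactFunctor_extClass, ← hz]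
    refine (res_res (Ideal.pow_le_pow_right h') (Ideal.pow_le_pow_right h) x).symm.trans ?_
    refine (congrArg (fun t => res (Ideal.pow_le_pow_right h') t) hw.symm).trans ?_
    exact res_comp _ w _ _

end LCV

namespace LCV

theorem res_zero {R : Type u} [CommRing R] {a b : Ideal R} (h : a ≤ b)
    {M : ModuleCat.{u} R} {i : ℕ} : res h (0 : Ext (Q b) M i) = 0 :=
  Ext.comp_zero _ _ _ _ _

/-- exponents `1 + p + ... + p^(e-1)` -/
def expo (p : ℕ) : ℕ → ℕ
  | 0 => 0
  | e + 1 => p * expo p e + 1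

theorem le_expo (p : ℕ) (hp : 1 ≤ p) (e : ℕ) : e ≤ expo p e := by
  induction e with
  | zero => exact le_rfl
  | succ e ih =>
    have : 1 * expo p e ≤ p * expo p e := Nat.mul_le_mul_right _ hp
    simp only [expo]
    omega

theorem theta_iter {R : Type u} [CommRing R] (p : ℕ) (θ : R → R)
    (hθ_lin : ∀ a b : R, θ (a ^ p * b) = a * θ b) (e : ℕ) :
    ∀ a b : R, θ^[e] (a ^ p ^ e * b) = a * θ^[e] b := by
  induction e with
  | zero => intro a b; simp
  | succ e ih =>
    intro a b
    rw [Function.iterate_succ_apply, pow_succ, pow_mul, hθ_lin, ih, Function.iterate_succ_apply]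

theorem theta_expo {R : Type u} [CommRing R] (p : ℕ) (f : R) (θ : R → R)
    (hθ_lin : ∀ a b : R, θ (a ^ p * b) = a * θ b) (hθ_f : θ f = 1) (e : ℕ) (he : 1 ≤ e) :
    θ^[e] (f ^ expo p e) = 1 := by
  induction e, he using Nat.le_induction with
  | base => simp [expo, hθ_f]
  | succ e he ih =>
    rw [Function.iterate_succ_apply, expo, pow_add, mul_comm p, pow_mul, hθ_lin, pow_one, hθ_f,
      mul_one, ih]

theorem newmain (p : ℕ) (hp : p.Prime)
    (R : Type u) [CommRing R] [IsNoetherianRing R] [CharP R p] (I : Ideal R)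
    (f : R) (i : ℕ)
    (θ : R → R)
    (hθ_add : ∀ a b : R, θ (a + b) = θ a + θ b)
    (hθ_lin : ∀ a b : R, θ (a ^ p * b) = a * θ b)
    (hθ_f : θ f = 1)
    (N : ℕ) (hN : 1 ≤ N)
    (hkill : ∀ (n : ℕ) (x : Ext (Q (I ^ n)) (ModuleCat.of R R) i), ∃ m, ∃ h : n ≤ m,
      res (Ideal.pow_le_pow_right h)
        (x.comp (Ext.mk₀ (f ^ N • 𝟙 (ModuleCat.of R R))) (add_zero _)) = 0)
    (n : ℕ) (x : Ext (Q (I ^ n)) (ModuleCat.of R R) i) :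
    ∃ m, ∃ h : n ≤ m, res (Ideal.pow_le_pow_right h) x = 0 := by
  have : Fact p.Prime := ⟨hp⟩
  have : ExpChar R p := ExpChar.prime hp
  let A : ModuleCat.{u} R := ModuleCat.of R R
  let φ : R →+* R := iterateFrobenius R p N
  have hφ : ∀ r, φ r = r ^ p ^ N := fun r => iterateFrobenius_def p N r
  let F := ModuleCat.restrictScalars.{u} φ
  obtain ⟨c, hc⟩ := Nat.exists_eq_add_of_le (le_expo p hp.one_le N)
  let g := f ^ expo p N
  let j₀ : A ⟶ F.obj A := ModuleCat.semilinearMapAddEquiv φ A A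
    { toFun := φ
      map_add' := map_add φ
      map_smul' := fun r y => map_mul φ r y }
  let th : F.obj A ⟶ A := ModuleCat.ofHom (X := F.obj A) (Y := A)
    { toFun := fun y => (θ^[N] (y : R) : R)
      map_add' := by
        have : ∀ e (a b : R), θ^[e] (a + b) = θ^[e] a + θ^[e] b := by
          intro e
          induction e with
          | zero => intro a b; rfl
          | succ e ih => intro a b; simp only [Function.iterate_succ_apply, hθ_add, ih]
        exact this N
      map_smul' := by
        intro r y
        have := theta_iter p θ hθ_lin N r y
        rw [← hφ] at this
        exact this }
  have hsplit : j₀ ≫ F.map (g • 𝟙 A) ≫ th = 𝟙 A := by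
    apply ModuleCat.hom_ext
    apply LinearMap.ext_ring
    change θ^[N] (g * φ 1) = 1
    rw [map_one, mul_one]
    exact theta_expo p f θ hθ_lin hθ_f N hN
  obtain ⟨m, h, z, hz⟩ := step3 φ I i A n (x.comp (Ext.mk₀ j₀) (add_zero _))
  obtain ⟨k, hk⟩ := Ideal.exists_pow_le_of_le_radical_of_fg (I := I) (J := (I ^ m).map φ)
    (by
      intro r hr
      refine ⟨m * p ^ N, ?_⟩
      rw [pow_mul, ← hφ]
      exact Ideal.mem_map_of_mem _ (Ideal.pow_mem_pow hr m)) (IsNoetherian.noetherian I)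
  obtain ⟨k', hkk', hk'⟩ := hkill k (res hk z)
  have hle : (I ^ (max m k')).map φ ≤ I ^ k' := by
    rw [Ideal.map_le_iff_le_comap]
    intro r hr
    rw [Ideal.mem_comap, hφ]
    exact Ideal.pow_mem_of_mem _ (Ideal.pow_le_pow_right (le_max_right _ _) hr) _
      (pow_pos hp.pos N)
  have hm' : I ^ max m k' ≤ I ^ m := Ideal.pow_le_pow_right (le_max_left _ _)
  have hfz : res (Ideal.map_mono hm') (z.comp (Ext.mk₀ (f ^ N • 𝟙 A)) (add_zero _)) = 0 := by
    have h1 := congrArg (fun t => res hle t) hk'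
    simp only [res_zero] at h1
    rw [res_res, ← res_comp hk, res_res] at h1
    exact h1
  have hgz : res (Ideal.map_mono hm') (z.comp (Ext.mk₀ (g • 𝟙 A)) (add_zero _)) = 0 := by
    have hg : g • 𝟙 A = (f ^ N • 𝟙 A) ≫ (f ^ c • 𝟙 A) := by
      rw [Linear.smul_comp, Category.id_comp, smul_smul, ← pow_add, ← hc]
    have h2 := res_comp_eq_zero _ _ (Ext.mk₀ (f ^ c • 𝟙 A)) (add_zero _) hfz
    rw [Ext.comp_assoc _ _ _ _ (add_zero _) (by omega), Ext.mk₀_comp_mk₀, ← hg] at h2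
    exact h2
  refine ⟨max m k', h.trans (le_max_left _ _), ?_⟩
  have hx : x = ((x.comp (Ext.mk₀ j₀) (add_zero _)).comp
      ((Ext.mk₀ (g • 𝟙 A)).mapExactFunctor F) (add_zero _)).comp (Ext.mk₀ th) (add_zero _) := by
    rw [Ext.mapExactFunctor_mk₀, Ext.comp_assoc _ _ _ (add_zero _) (add_zero _) (by omega),
      Ext.comp_assoc _ _ _ (add_zero _) (add_zero _) (by omega), Ext.mk₀_comp_mk₀,
      Ext.mk₀_comp_mk₀, hsplit, Ext.comp_mk₀_id]
  have h3 : res hm' (res (Ideal.pow_le_pow_right h) x) = 0 := by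
    have hr : res (Ideal.pow_le_pow_right h) x =
        (cmp φ (I ^ m) (z.comp (Ext.mk₀ (g • 𝟙 A)) (add_zero _))).comp (Ext.mk₀ th)
          (add_zero _) := by
      rw [cmp_comp, ← hz, ← res_comp (Ideal.pow_le_pow_right h) (x.comp (Ext.mk₀ j₀) _),
        ← res_comp (Ideal.pow_le_pow_right h) ((x.comp (Ext.mk₀ j₀) _).comp _ _), ← hx]
    rw [hr, res_comp hm', cmp_res, hgz]
    have : cmp φ (I ^ max m k') (0 : Ext _ A i) = 0 := by
      simp [cmp, Ext.mapExactFunctor_zero]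
    rw [this, Ext.zero_comp]
  rw [res_res] at h3
  exact h3

end LCV

namespace LCV

/-- functoriality of the Hom complex -/
noncomputable def ymap {R : Type u} [CommRing R] {K L : ChainComplex (ModuleCat.{u} R) ℕ} (φ : K ⟶ L)
    (Y : ModuleCat.{u} R) : L.linearYonedaObj R Y ⟶ K.linearYonedaObj R Y :=
  (HomologicalComplex.unopFunctor (ModuleCat.{u} R) (ComplexShape.down ℕ)).map
    ((((linearYoneda R (ModuleCat.{u} R)).obj Y).rightOp.mapHomologicalComplex _).map φ).op

theorem ymap_f {R : Type u} [CommRing R] {K L : ChainComplex (ModuleCat.{u} R) ℕ} (φ : K ⟶ L)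
    (Y : ModuleCat.{u} R) (n : ℕ) (c : L.X n ⟶ Y) :
    ((ymap φ Y).f n).hom c = φ.f n ≫ c := rfl

theorem yd {R : Type u} [CommRing R] (K : ChainComplex (ModuleCat.{u} R) ℕ)
    (Y : ModuleCat.{u} R) (n m : ℕ) (c : K.X n ⟶ Y) :
    ((K.linearYonedaObj R Y).d n m).hom c = K.d m n ≫ c := rfl

theorem unop_square {C : Type*} [Category C] {A A' B B' : Cᵒᵖ} {H H' : C} (a : A' ⟶ A)
    (α : A ≅ B) (α' : A' ≅ B') (b : B' ⟶ B) (β : B ≅ Opposite.op H) (β' : B' ≅ Opposite.op H')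
    (m : H ⟶ H') (h : a ≫ α.hom = α'.hom ≫ b) (h2 : b ≫ β.hom = β'.hom ≫ m.op) :
    a.unop ≫ (α'.unop.symm ≪≫ β'.unop.symm).hom = (α.unop.symm ≪≫ β.unop.symm).hom ≫ m := by
  apply Quiver.Hom.op_inj
  simp only [Iso.trans_hom, Iso.symm_hom, Iso.unop_inv, op_comp, Quiver.Hom.op_unop,
    Category.assoc]
  rw [Iso.inv_comp_eq, ← reassoc_of% h2, Iso.hom_inv_id_assoc, Iso.inv_comp_eq, ← reassoc_of% h,
    Iso.hom_inv_id, Category.comp_id]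

theorem isoExt_nat {R : Type u} [CommRing R] {X X' : ModuleCat.{u} R} (g : X' ⟶ X)
    (P : ProjectiveResolution X) (P' : ProjectiveResolution X')
    (φ : ProjectiveResolution.Hom P' P g) (n : ℕ) (Y : ModuleCat.{u} R) :
    ((_root_.Ext R (ModuleCat.{u} R) n).map g.op).app Y ≫ (P'.isoExt n Y).hom =
      (P.isoExt n Y).hom ≫ HomologicalComplex.homologyMap (ymap φ.hom Y) n := by
  have h := ProjectiveResolution.isoLeftDerivedObj_hom_naturality g P' P φ.hom
    φ.hom_f_zero_comp_π_f_zero ((linearYoneda R (ModuleCat.{u} R)).obj Y).rightOp n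
  let F := ((linearYoneda R (ModuleCat.{u} R)).obj Y).rightOp
  let H (P : ChainComplex (ModuleCat.{u} R) ℕ) : ModuleCat.{u} R :=
    HomologicalComplex.homology (P.linearYonedaObj R Y) n
  let β (P : ChainComplex (ModuleCat.{u} R) ℕ) : (F.mapHomologicalComplex (ComplexShape.down ℕ) ⋙
            HomologicalComplex.homologyFunctor (ModuleCat R)ᵒᵖ (ComplexShape.down ℕ) n).obj
        P ≅ Opposite.op (H P) :=
    HomologicalComplex.homologyOp (P.linearYonedaObj R Y) n
  have h2 : (F.mapHomologicalComplex (ComplexShape.down ℕ) ⋙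
            HomologicalComplex.homologyFunctor (ModuleCat R)ᵒᵖ (ComplexShape.down ℕ) n).map
        φ.hom ≫ (β P.complex).hom = (β P'.complex).hom ≫
        Quiver.Hom.op (X := H P.complex) (Y := H P'.complex)
          (HomologicalComplex.homologyMap (ymap φ.hom Y) n) :=
    HomologicalComplex.homologyOp_hom_naturality (ymap φ.hom Y) n
  exact unop_square ((F.leftDerived n).map g) (P.isoLeftDerivedObj F n) (P'.isoLeftDerivedObj F n)
    _ (β _) (β _) (HomologicalComplex.homologyMap (ymap φ.hom Y) n) h h2

end LCV

namespace LCV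

theorem homπ_zero_iff {R : Type u} [CommRing R] (L : CochainComplex (ModuleCat.{u} R) ℕ) (i j : ℕ)
    (hj : (ComplexShape.up ℕ).prev i = j) (z : L.cycles i) :
    (L.homologyπ i).hom z = 0 ↔ ∃ b : L.X j, (L.d j i).hom b = (L.iCycles i).hom z := by
  have hinj : Function.Injective (L.iCycles i).hom :=
    (ModuleCat.mono_iff_injective _).1 inferInstance
  have ht : ∀ b : L.X j, (L.iCycles i).hom ((L.toCycles j i).hom b) = (L.d j i).hom b := by
    intro b
    exact ConcreteCategory.congr_hom (L.toCycles_i j i) b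
  have hex : (ShortComplex.mk (L.toCycles j i) (L.homologyπ i)
      (L.toCycles_comp_homologyπ j i)).Exact :=
    ShortComplex.exact_of_g_is_cokernel _ (L.homologyIsCokernel j i hj)
  constructor
  · intro h
    obtain ⟨b, hb⟩ := (ShortComplex.moduleCat_exact_iff _).1 hex z h
    refine ⟨b, ?_⟩
    rw [← ht]
    exact congrArg _ hb
  · rintro ⟨b, hb⟩
    rw [← ht] at hb
    rw [← hinj hb]
    exact ConcreteCategory.congr_hom (L.toCycles_comp_homologyπ j i) b

theorem exists_cycle {R : Type u} [CommRing R] (L : CochainComplex (ModuleCat.{u} R) ℕ) (i : ℕ)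
    (c : L.X i) (hc : (L.d i (i + 1)).hom c = 0) : ∃ z : L.cycles i, (L.iCycles i).hom z = c := by
  have hex : (ShortComplex.mk (L.iCycles i) (L.d i (i + 1)) (L.iCycles_d i (i + 1))).Exact :=
    ShortComplex.exact_of_f_is_kernel _ (L.cyclesIsKernel i (i + 1) (by simp))
  exact (ShortComplex.moduleCat_exact_iff _).1 hex c hc

/-- the old Ext -/
noncomputable abbrev oExt {R : Type u} [CommRing R] (X Y : ModuleCat.{u} R) (i : ℕ) :
    ModuleCat.{u} R :=
  ((_root_.Ext R (ModuleCat.{u} R) i).obj (Opposite.op X)).obj Y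

/-- A cocycle represents a class. -/
def Rep {R : Type u} [CommRing R] {X Y : ModuleCat.{u} R} (P : ProjectiveResolution X) {i : ℕ}
    (c : P.complex.X i ⟶ Y) (e : oExt X Y i) : Prop :=
  ∃ z : (P.complex.linearYonedaObj R Y).cycles i,
    ((P.complex.linearYonedaObj R Y).homologyπ i).hom z = (P.isoExt i Y).hom.hom e ∧
    ((P.complex.linearYonedaObj R Y).iCycles i).hom z = c

variable {R : Type u} [CommRing R] {X X' Y : ModuleCat.{u} R} (P : ProjectiveResolution X)
  (P' : ProjectiveResolution X') {i : ℕ}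

theorem rep_exists (e : oExt X Y i) :
    ∃ c : P.complex.X i ⟶ Y, P.complex.d (i + 1) i ≫ c = 0 ∧ Rep P c e := by
  obtain ⟨z, hz⟩ := (ModuleCat.epi_iff_surjective
    ((P.complex.linearYonedaObj R Y).homologyπ i)).1 inferInstance ((P.isoExt i Y).hom.hom e)
  refine ⟨((P.complex.linearYonedaObj R Y).iCycles i).hom z, ?_, z, hz, rfl⟩
  exact ConcreteCategory.congr_hom ((P.complex.linearYonedaObj R Y).iCycles_d i (i + 1)) z

theorem rep_of_cocycle (c : P.complex.X i ⟶ Y) (hc : P.complex.d (i + 1) i ≫ c = 0) :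
    ∃ e : oExt X Y i, Rep P c e := by
  obtain ⟨z, hz⟩ := exists_cycle (P.complex.linearYonedaObj R Y) i c hc
  refine ⟨(P.isoExt i Y).inv.hom (((P.complex.linearYonedaObj R Y).homologyπ i).hom z), z, ?_, hz⟩
  exact (ConcreteCategory.congr_hom (P.isoExt (R := R) i Y).inv_hom_id _).symm

variable {P P'} in
theorem Rep.zero_iff {c : P.complex.X i ⟶ Y} {e : oExt X Y i} (h : Rep P c e) (j : ℕ)
    (hj : (ComplexShape.up ℕ).prev i = j) :
    e = 0 ↔ ∃ b : P.complex.X j ⟶ Y, P.complex.d i j ≫ b = c := by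
  obtain ⟨z, hz, rfl⟩ := h
  have h1 := homπ_zero_iff (P.complex.linearYonedaObj R Y) i j hj z
  rw [hz] at h1
  have hinj : Function.Injective (P.isoExt (R := R) i Y).hom.hom :=
    (ModuleCat.mono_iff_injective _).1 inferInstance
  rw [← map_zero (P.isoExt (R := R) i Y).hom.hom, hinj.eq_iff] at h1
  exact h1

variable {P P'} in
theorem Rep.smul {c : P.complex.X i ⟶ Y} {e : oExt X Y i} (h : Rep P c e) (r : R) :
    Rep P (r • c) (r • e) := by
  obtain ⟨z, hz, rfl⟩ := h
  refine ⟨r • z, ?_, ?_⟩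
  · rw [map_smul, hz, map_smul]
  · rw [map_smul]
    rfl

variable {P P'} in
theorem Rep.nat {g : X' ⟶ X} (φ : ProjectiveResolution.Hom P' P g) {c : P.complex.X i ⟶ Y}
    {e : oExt X Y i} (h : Rep P c e) :
    Rep P' (φ.hom.f i ≫ c) ((((_root_.Ext R (ModuleCat.{u} R) i).map g.op).app Y).hom e) := by
  obtain ⟨z, hz, rfl⟩ := h
  refine ⟨(HomologicalComplex.cyclesMap (ymap φ.hom Y) i).hom z, ?_, ?_⟩
  · refine (ConcreteCategory.congr_hom
      (HomologicalComplex.homologyπ_naturality (ymap φ.hom Y) i) z).symm.trans ?_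
    refine Eq.trans ?_ (ConcreteCategory.congr_hom (isoExt_nat g P P' φ i Y) e).symm
    exact congrArg (HomologicalComplex.homologyMap (ymap φ.hom Y) i).hom hz
  · exact ConcreteCategory.congr_hom (HomologicalComplex.cyclesMap_i (ymap φ.hom Y) i) z

/-- uniform vanishing criterion -/
theorem extMk_zero_iff (c : P.complex.X i ⟶ Y) (hc : P.complex.d (i + 1) i ≫ c = 0) (j : ℕ)
    (hj : (ComplexShape.up ℕ).prev i = j) :
    P.extMk c (i + 1) rfl hc = 0 ↔ ∃ b : P.complex.X j ⟶ Y, P.complex.d i j ≫ b = c := by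
  cases i with
  | succ i =>
    have : j = i := by simpa using hj.symm
    subst this
    exact P.extMk_eq_zero_iff c _ rfl hc j rfl
  | zero =>
    have : j = 0 := by simpa using hj.symm
    subst this
    rw [P.complex.shape 0 0 (by simp)]
    simp only [zero_comp, exists_const]
    have hz : IsZero (P.cochainComplex.X 1) := by
      exact P.cochainComplex.isZero_of_isStrictlyLE 0 1 (by norm_num)
    constructor
    · intro h
      rw [← P.extEquivCohomologyClass.apply_eq_iff_eq, P.extEquivCohomologyClass_extMk,
        P.extEquivCohomologyClass_zero, CochainComplex.HomComplex.CohomologyClass.mk_eq_zero_iff,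
        CochainComplex.HomComplex.Cocycle.toSingleMk_mem_coboundaries_iff _ _ _ _ _ 1 (by simp)] at h
      obtain ⟨b, hb⟩ := h
      rw [hz.eq_of_src b 0, comp_zero] at hb
      rw [← cancel_epi (P.cochainComplexXIso _ _ _).hom, ← hb, comp_zero]
      rfl
    · rintro h
      have : c = 0 := h.symm
      subst this
      exact P.extMk_zero _ rfl

end LCV

namespace LCV

/-- transition maps on the old Ext -/
noncomputable abbrev otr {R : Type u} [CommRing R] {a b : Ideal R} (h : a ≤ b)
    {M : ModuleCat.{u} R} {i : ℕ} (e : oExt (Q b) M i) : oExt (Q a) M i :=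
  (((_root_.Ext R (ModuleCat.{u} R) i).map (tr h).op).app M).hom e

theorem lc_facts {R : Type u} [CommRing R] (I : Ideal R) (i : ℕ) (A : ModuleCat.{u} R) :
    ∃ ι : ∀ n : ℕ, oExt (Q (I ^ n)) A i →ₗ[R] (localCohomology I i).obj A,
      (∀ x, ∃ n e, ι n e = x) ∧
      (∀ n e, ι n e = 0 ↔ ∃ m, ∃ h : n ≤ m, otr (Ideal.pow_le_pow_right h) e = 0) := by
  let D := localCohomology.diagram (localCohomology.idealPowersDiagram I) i
  have := localCohomology.hasColimitDiagram.{u, 0} (localCohomology.idealPowersDiagram I) i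
  let ev := (evaluation (ModuleCat.{u} R) (ModuleCat.{u} R)).obj A
  let hcol := isColimitOfPreserves ev (colimit.isColimit D)
  let F := D ⋙ ev
  have hpres : PreservesFilteredColimitsOfSize.{0, 0} (forget (ModuleCat.{u} R)) :=
    preservesFilteredColimitsOfSize_shrink.{0, u, 0, u} _
  have hpres' : PreservesColimit F (forget (ModuleCat.{u} R)) := inferInstance
  refine ⟨fun n => ((ev.mapCocone (colimit.cocone D)).ι.app (Opposite.op (Opposite.op n))).hom,
    ?_, ?_⟩
  · intro x
    obtain ⟨j, e, he⟩ := Concrete.isColimit_exists_rep F hcol x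
    exact ⟨j.unop.unop, e, he⟩
  · intro n e
    constructor
    · intro h
      obtain ⟨k, f, g, hfg⟩ := Concrete.isColimit_exists_of_rep_eq F hcol
        (i := Opposite.op (Opposite.op n)) (j := Opposite.op (Opposite.op n)) e
        (0 : oExt (Q (I ^ n)) A i) (h.trans (map_zero
          ((ev.mapCocone (colimit.cocone D)).ι.app (Opposite.op (Opposite.op n))).hom).symm)
      refine ⟨k.unop.unop, f.unop.unop.down.down, ?_⟩
      exact hfg.trans (map_zero (F.map g).hom)
    · rintro ⟨m, h, hm⟩
      let f : Opposite.op (Opposite.op n) ⟶ Opposite.op (Opposite.op m) := (homOfLE h).op.op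
      have h1 := ConcreteCategory.congr_hom ((ev.mapCocone (colimit.cocone D)).w f) e
      refine h1.symm.trans ?_
      refine (congrArg ((ev.mapCocone (colimit.cocone D)).ι.app
        (Opposite.op (Opposite.op m))).hom (show (F.map f).hom e = 0 from hm)).trans ?_
      exact map_zero ((ev.mapCocone (colimit.cocone D)).ι.app (Opposite.op (Opposite.op m))).hom

theorem exists_hom {R : Type u} [CommRing R] {X X' : ModuleCat.{u} R} (g : X' ⟶ X)
    (P' : ProjectiveResolution X') (P : ProjectiveResolution X) :
    Nonempty (ProjectiveResolution.Hom P' P g) :=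
  ⟨{ hom := ProjectiveResolution.lift g P' P
     hom_f_zero_comp_π_f_zero :=
      HomologicalComplex.congr_hom (ProjectiveResolution.lift_commutes g P' P) 0 }⟩

/-- compare vanishing of restrictions -/
theorem compare {R : Type u} [CommRing R] {a b : Ideal R} (h : a ≤ b) {M : ModuleCat.{u} R} {i : ℕ}
    (P : ProjectiveResolution (Q b)) (c : P.complex.X i ⟶ M)
    (hc : P.complex.d (i + 1) i ≫ c = 0) {e : oExt (Q b) M i} (hr : Rep P c e) :
    otr h e = 0 ↔ res h (P.extMk c (i + 1) rfl hc) = 0 := by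
  let P' := projectiveResolution (Q a)
  obtain ⟨φ⟩ := exists_hom (tr h) P' P
  rw [(hr.nat φ).zero_iff _ rfl]
  dsimp only [res]
  rw [ProjectiveResolution.mk₀_comp_extMk (φ := φ), extMk_zero_iff P' _ _ _ rfl]

end LCV

/-- Let `p` be a prime, `(R, m)` a Noetherian local ring of
characteristic `p`, `f ∈ R` and `i ≥ 0`.  If `R` splits relative to `f`
(there is a `p⁻¹`-linear map `θ : R → R` with `θ f = 1`) and some power `f ^ N`
(`N ≥ 1`) kills the local cohomology `H^i_m(R)`, then `H^i_m(R) = 0`. -/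
theorem local_cohomology_vanishes_of_relative_split
    (p : ℕ) (hp : p.Prime)
    (R : Type u) [CommRing R] [IsLocalRing R] [IsNoetherianRing R] [CharP R p]
    (f : R) (i : ℕ)
    (θ : R → R)
    (hθ_add : ∀ a b : R, θ (a + b) = θ a + θ b)
    (hθ_lin : ∀ a b : R, θ (a ^ p * b) = a * θ b)
    (hθ_f : θ f = 1)
    (N : ℕ) (hN : 1 ≤ N)
    (hkill : ∀ x : (localCohomology (IsLocalRing.maximalIdeal R) i).obj (ModuleCat.of R R),
      f ^ N • x = 0) :
    ∀ x : (localCohomology (IsLocalRing.maximalIdeal R) i).obj (ModuleCat.of R R),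
      x = 0 := by
  let I := IsLocalRing.maximalIdeal R
  obtain ⟨ι, h1, h2⟩ := LCV.lc_facts I i (ModuleCat.of R R)
  intro x
  obtain ⟨n, e, rfl⟩ := h1 x
  rw [h2]
  let P := projectiveResolution (LCV.Q (I ^ n))
  obtain ⟨c, hc, hr⟩ := LCV.rep_exists P e
  obtain ⟨m, h, hm⟩ := LCV.newmain p hp R I f i θ hθ_add hθ_lin hθ_f N hN (by
    intro n x
    let P := projectiveResolution (LCV.Q (I ^ n))
    obtain ⟨c, hc, rfl⟩ := P.extMk_surjective x (i + 1) rfl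
    obtain ⟨e, he⟩ := LCV.rep_of_cocycle P c hc
    have h3 := hkill (ι n e)
    rw [← map_smul, h2] at h3
    obtain ⟨m, h, hm⟩ := h3
    have hc' : P.complex.d (i + 1) i ≫ (f ^ N • c) = 0 := by
      rw [Linear.comp_smul, hc, smul_zero]
    refine ⟨m, h, ?_⟩
    rw [LCV.compare _ P _ hc' (he.smul (f ^ N))] at hm
    rw [P.extMk_comp_mk₀]
    simp only [Linear.comp_smul, Category.comp_id]
    exact hm) n (P.extMk c (i + 1) rfl hc)
  exact ⟨m, h, (LCV.compare _ P c hc hr).2 hm⟩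
end

section
/- Let p be a prime, let k be a field of characteristic p, and let (R, m) be a Noetherian local ring of characteristic p that is the localization of a finite type k-algebra at a prime ideal. Let f ∈ m be a nonzerodivisor such that the localization R_f is Cohen-Macaulay, and suppose that R splits relative to f, i.e. there exists a p^{-1}-linear map θ: R → R with θ(f) = 1. Then R is a Cohen-Macaulay local ring. -/
/-- A Noetherian local ring is Cohen-Macaulay iff its depth equals its Krull dimension;
equivalently (and this is the definition we use), iff there exists a regular sequence,
consisting of elements of the maximal ideal, whose length equals the Krull dimension. -/
def IsCohenMacaulayLocalRing (R : Type*) [CommRing R] [IsLocalRing R] : Prop :=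
  ∃ rs : List R, (∀ r ∈ rs, r ∈ IsLocalRing.maximalIdeal R) ∧
    RingTheory.Sequence.IsRegular R rs ∧ (rs.length : WithBot ℕ∞) = ringKrullDim R

/-- A Noetherian ring is Cohen-Macaulay if its localization at every prime ideal is a
Cohen-Macaulay local ring. -/
def IsCohenMacaulayRing (A : Type*) [CommRing A] : Prop :=
  ∀ (P : Ideal A) (hP : P.IsPrime), IsCohenMacaulayLocalRing (@Localization.AtPrime A _ P hP)

universe u

section cmfsHelpers
open RingTheory.Sequence Pointwise IsLocalRing

theorem cmfs_L0 {R : Type*} [CommRing R] [IsLocalRing R] [IsNoetherianRing R] (rs : List R) :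
    ∀ {M : Type _} [AddCommGroup M] [Module R M] [Module.Finite R M]
    (_ : ∀ r ∈ rs, r ∈ maximalIdeal R) (_ : IsRegular M rs) (p : Ideal R)
    (_ : IsAssociatedPrime p M), (rs.length : WithBot ℕ∞) ≤ ringKrullDim (R ⧸ p) := by
  induction rs with
  | nil =>
    intro M _ _ _ _ _ p hp
    have := hp.isPrime
    simpa using (ringKrullDim_nonneg_of_nontrivial (R := R ⧸ p))
  | cons r rs ih =>
    intro M _ _ _ hmem hreg p hp
    have hpp := hp.isPrime
    rw [isRegular_cons_iff] at hreg
    obtain ⟨hr, hreg'⟩ := hreg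
    have hrm := hmem r (by simp)
    obtain ⟨_, x, hx⟩ := isAssociatedPrime_iff.mp hp
    have hx0 : x ≠ 0 := by
      rintro rfl
      apply hpp.ne_top
      rw [hx, Ideal.eq_top_iff_one]; simp
    have hrp : r ∉ p := by
      intro h
      rw [hx, Submodule.mem_colon_singleton] at h
      exact hx0 (hr.right_eq_zero_of_smul (by simpa using h) )
    let N : Submodule R M :=
      { carrier := {m | ∀ a ∈ p, a • m = 0}
        add_mem' := by intro a b ha hb c hc; simp [ha c hc, hb c hc]
        zero_mem' := by intro a _; simp
        smul_mem' := by intro c m hm a ha; rw [smul_comm, hm a ha, smul_zero] }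
    have hxN : x ∈ N := by
      intro a ha
      rw [hx, Submodule.mem_colon_singleton] at ha
      simpa using ha
    have hex : ∃ y ∈ N, y ∉ r • (⊤ : Submodule R M) := by
      by_contra! hcon
      have hN : N ≤ (Ideal.span {r}) • N := by
        intro y hy
        obtain ⟨z, -, hz⟩ := (Submodule.mem_smul_pointwise_iff_exists _ _ _).mp (hcon y hy)
        rw [Submodule.ideal_span_singleton_smul, ← hz]
        refine Submodule.smul_mem_pointwise_smul _ _ _ ?_
        intro a ha
        have := hy a ha
        rw [← hz, smul_comm] at this
        exact hr.right_eq_zero_of_smul this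
      have hb := Submodule.eq_bot_of_le_smul_of_le_jacobson_bot (Ideal.span {r}) N
        (IsNoetherian.noetherian N) hN (by
          rw [Ideal.span_singleton_le_iff_mem]
          exact IsLocalRing.maximalIdeal_le_jacobson _ hrm)
      rw [hb] at hxN
      exact hx0 (by simpa using hxN)
    obtain ⟨y, hyN, hy⟩ := hex
    let y' : QuotSMulTop r M := Submodule.Quotient.mk y
    have hy' : y' ≠ 0 := by
      intro h
      exact hy ((Submodule.Quotient.mk_eq_zero _).mp h)
    obtain ⟨q, hq, hle⟩ := exists_le_isAssociatedPrime_of_isNoetherianRing R y' hy'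
    have hqp := hq.isPrime
    have h1 := ih (M := QuotSMulTop r M) (fun s hs => hmem s (by simp [hs])) hreg' q hq
    have hpq : p ≤ q := by
      intro a ha
      apply hle
      rw [Submodule.mem_colon_singleton, Submodule.mem_bot]
      change Submodule.Quotient.mk (a • y) = _
      rw [hyN a ha]; rfl
    have hrq : r ∈ q := by
      apply hle
      rw [Submodule.mem_colon_singleton, Submodule.mem_bot]
      change Submodule.Quotient.mk (r • y) = _
      exact (Submodule.Quotient.mk_eq_zero _).mpr (Submodule.smul_mem_pointwise_smul _ _ _ trivial)
    have h2 : ringKrullDim (R ⧸ q) + 1 ≤ ringKrullDim (R ⧸ p) := by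
      have hnz : (Ideal.Quotient.mk p r) ∈ nonZeroDivisors (R ⧸ p) := by
        rw [mem_nonZeroDivisors_iff_ne_zero]
        rwa [Ne, Ideal.Quotient.eq_zero_iff_mem]
      refine le_trans ?_ (ringKrullDim_quotient_succ_le_of_nonZeroDivisor hnz)
      gcongr
      let φ : (R ⧸ p) ⧸ Ideal.span {Ideal.Quotient.mk p r} →+* R ⧸ q :=
        Ideal.Quotient.lift _ (Ideal.Quotient.factor hpq) (by
          intro a ha
          obtain ⟨b, rfl⟩ := Ideal.mem_span_singleton'.mp ha
          rw [map_mul, Ideal.Quotient.factor_mk, Ideal.Quotient.eq_zero_iff_mem.mpr hrq, mul_zero])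
      refine ringKrullDim_le_of_surjective φ ?_
      intro a
      obtain ⟨a, rfl⟩ := Ideal.Quotient.mk_surjective a
      exact ⟨Ideal.Quotient.mk _ (Ideal.Quotient.mk _ a), by simp [φ]⟩
    refine le_trans ?_ h2
    rw [List.length_cons]; push_cast
    gcongr

theorem cmfs_dim_le {S : Type*} [CommRing S] [IsLocalRing S] [IsNoetherianRing S] (ys : List S)
    (hys : ∀ y ∈ ys, y ∈ maximalIdeal S)
    (h : ∀ P : Ideal S, P.IsPrime → Ideal.ofList ys ≤ P → P = maximalIdeal S) :
    ringKrullDim S ≤ ys.length := by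
  classical
  have hle : Ideal.ofList ys ≤ maximalIdeal S := by
    rw [Ideal.ofList, Ideal.span_le]; exact hys
  have hmin : maximalIdeal S ∈ (Ideal.span (ys.toFinset : Set S)).minimalPrimes := by
    refine ⟨⟨inferInstance, ?_⟩, ?_⟩
    · simpa [Ideal.ofList] using hle
    · rintro Q ⟨hQ, hQ2⟩ hQ3
      rw [h Q hQ (by simpa [Ideal.ofList] using hQ2)]
  have := Ideal.height_le_card_of_mem_minimalPrimes_span_finset hmin
  rw [← IsLocalRing.maximalIdeal_height_eq_ringKrullDim]
  refine le_trans (WithBot.coe_le_coe.mpr this) ?_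
  exact_mod_cast List.toFinset_card_le _

open CategoryTheory Abelian Limits in
theorem cmfs_rees {R : Type u} [CommRing R] [IsLocalRing R] [IsNoetherianRing R]
    (M : Type u) [AddCommGroup M] [Module R M] [Module.Finite R M] (rs : List R)
    (hmem : ∀ r ∈ rs, r ∈ maximalIdeal R) (hreg : IsRegular M rs) (x : R) (hx : x ∈ maximalIdeal R)
    (hxr : IsSMulRegular M x) (n : ℕ) (hn : rs.length = n + 1) :
    ∃ rs' : List R, rs'.length = n ∧ (∀ r ∈ rs', r ∈ maximalIdeal R) ∧
      IsRegular (QuotSMulTop x M) rs' := by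
  have hnt : Nontrivial M := hreg.nontrivial
  have key : ∀ (N : Type u) [AddCommGroup N] [Module R N] [Module.Finite R N] [Nontrivial N],
      maximalIdeal R • (⊤ : Submodule R N) < ⊤ := by
    intro N _ _ _ _
    rw [lt_top_iff_ne_top]
    exact (Submodule.top_ne_ideal_smul_of_le_jacobson_annihilator
      (IsLocalRing.maximalIdeal_le_jacobson _)).symm
  let N := ModuleCat.of R (R ⧸ maximalIdeal R)
  have hsupp : Module.support R N = PrimeSpectrum.zeroLocus (maximalIdeal R) := by
    rw [Module.support_eq_zeroLocus, Ideal.annihilator_quotient]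
  have h_ext := ModuleCat.subsingleton_ext_of_exists_isRegular (maximalIdeal R) N hsupp.subset
    (ModuleCat.of R M) (key M) rs hmem hreg
  have : Nontrivial (QuotSMulTop x M) := by
    have := Submodule.top_ne_pointwise_smul_of_mem_jacobson_annihilator (R := R) (M := M) (r := x)
      (IsLocalRing.maximalIdeal_le_jacobson _ hx)
    exact Submodule.Quotient.nontrivial_iff.mpr this.symm
  refine ModuleCat.exists_isRegular_of_exists_subsingleton_ext (maximalIdeal R) n
    (ModuleCat.of R (QuotSMulTop x M)) (key _) N hsupp ?_
  intro i hi
  have zero1 := AddCommGrpCat.isZero_of_iff_subsingleton.mpr (h_ext i (by omega))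
  have zero2 := AddCommGrpCat.isZero_of_iff_subsingleton.mpr (h_ext (i + 1) (by omega))
  exact AddCommGrpCat.subsingleton_of_isZero <| ShortComplex.Exact.isZero_of_both_zeros
    ((Ext.covariant_sequence_exact₃' N
      (IsSMulRegular.smulShortComplex_shortExact (M := ModuleCat.of R M) hxr)) i (i + 1) rfl)
    (zero1.eq_zero_of_src _) (zero2.eq_zero_of_tgt _)

theorem cmfs_L1 {R : Type u} [CommRing R] [IsLocalRing R] [IsNoetherianRing R]
    (xs : List R) : ∀ {M : Type u} [AddCommGroup M] [Module R M] [Module.Finite R M] (rs : List R)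
    (_ : ∀ r ∈ rs, r ∈ maximalIdeal R) (_ : IsRegular M rs) (_ : rs.length = xs.length)
    (_ : ∀ r ∈ xs, r ∈ maximalIdeal R)
    (_ : ∀ P : Ideal R, P.IsPrime → Module.annihilator R M ≤ P → Ideal.ofList xs ≤ P →
      P = maximalIdeal R), IsRegular M xs := by
  induction xs with
  | nil =>
    intro M _ _ _ rs _ hreg hlen _ _
    have : rs = [] := by simpa using hlen
    exact this ▸ hreg
  | cons x xs ih =>
    intro M _ _ _ rs hrs hreg hlen hxs hP
    have hxm := hxs x (by simp)
    have hx : IsSMulRegular M x := by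
      by_contra hcon
      have : x ∈ ⋃ p ∈ associatedPrimes R M, (p : Set R) := by
        rw [biUnion_associatedPrimes_eq_zero_divisors]
        by_contra h
        apply hcon
        intro a b hab
        by_contra hne
        exact h ⟨a - b, sub_ne_zero.mpr hne, by rw [smul_sub, sub_eq_zero]; exact hab⟩
      simp only [Set.mem_iUnion] at this
      obtain ⟨p, hp, hxp⟩ := this
      have hp : IsAssociatedPrime p M := hp
      have hpp := hp.isPrime
      have h0 := cmfs_L0 rs hrs hreg p hp
      have : IsLocalRing (R ⧸ p) := IsLocalRing.of_surjective' _ Ideal.Quotient.mk_surjective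
      have hloc : IsLocalHom (Ideal.Quotient.mk p) :=
        IsLocalHom.of_surjective _ Ideal.Quotient.mk_surjective
      have h1 := cmfs_dim_le (S := R ⧸ p) (xs.map (Ideal.Quotient.mk p)) ?_ ?_
      · have := h0.trans h1
        rw [hlen, List.length_map, List.length_cons] at this
        have : xs.length + 1 ≤ xs.length := by exact_mod_cast this
        omega
      · intro y hy
        obtain ⟨z, hz, rfl⟩ := List.mem_map.mp hy
        intro hu
        exact (hxs z (by simp [hz])) ((isUnit_map_iff (Ideal.Quotient.mk p) z).mp hu)
      · intro P hPp hle
        have h2 := hP (P.comap (Ideal.Quotient.mk p)) inferInstance ?_ ?_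
        · rw [← Ideal.map_comap_of_surjective _ Ideal.Quotient.mk_surjective P, h2]
          have hml : Ideal.map (Ideal.Quotient.mk p) (maximalIdeal R) ≤ maximalIdeal (R ⧸ p) :=
            ((IsLocalRing.local_hom_TFAE (Ideal.Quotient.mk p)).out 0 2).mp hloc
          have : (Ideal.map (Ideal.Quotient.mk p) (maximalIdeal R)).IsMaximal :=
            Ideal.map_eq_top_or_isMaximal_of_surjective _ Ideal.Quotient.mk_surjective
              (maximalIdeal.isMaximal R) |>.resolve_left (fun h => by
                rw [h] at hml; exact (maximalIdeal.isMaximal _).ne_top (top_le_iff.mp hml))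
          exact IsLocalRing.eq_maximalIdeal this
        · have := hp.annihilator_le
          rw [Submodule.annihilator_top] at this
          refine this.trans ?_
          intro a ha
          rw [Ideal.mem_comap, Ideal.Quotient.eq_zero_iff_mem.mpr ha]; exact P.zero_mem
        · rw [Ideal.ofList_cons, sup_le_iff, Ideal.span_singleton_le_iff_mem]
          constructor
          · rw [Ideal.mem_comap, Ideal.Quotient.eq_zero_iff_mem.mpr hxp]; exact P.zero_mem
          · rw [← Ideal.map_le_iff_le_comap, Ideal.map_ofList]; exact hle
    obtain ⟨rs', h1, h2, h3⟩ := cmfs_rees M rs hrs hreg x hxm hx xs.length (by simpa using hlen)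
    rw [isRegular_cons_iff]
    refine ⟨hx, ih rs' h2 h3 h1 (fun r hr => hxs r (by simp [hr])) ?_⟩
    intro P hPp hann hle
    refine hP P hPp ?_ ?_
    · refine le_trans ?_ hann
      intro a ha
      rw [Module.mem_annihilator] at ha ⊢
      intro m
      obtain ⟨m, rfl⟩ := Submodule.Quotient.mk_surjective _ m
      rw [← Submodule.Quotient.mk_smul, ha m]; rfl
    · rw [Ideal.ofList_cons, sup_le_iff, Ideal.span_singleton_le_iff_mem]
      refine ⟨hann ?_, hle⟩
      rw [Module.mem_annihilator]
      intro m
      obtain ⟨m, rfl⟩ := Submodule.Quotient.mk_surjective _ m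
      rw [← Submodule.Quotient.mk_smul]
      exact (Submodule.Quotient.mk_eq_zero _).mpr (Submodule.smul_mem_pointwise_smul _ _ _ trivial)

theorem cmfs_exists_prime {S : Type*} [CommRing S] (n : ℕ) (h : (n : WithBot ℕ∞) ≤ ringKrullDim S) :
    ∃ P : Ideal S, P.IsPrime ∧ (n : WithBot ℕ∞) ≤ ringKrullDim (S ⧸ P) := by
  obtain ⟨l, hl⟩ := Order.le_krullDim_iff.mp h
  refine ⟨l.head.asIdeal, l.head.2, ?_⟩
  rw [ringKrullDim_quotient]
  let l' : LTSeries (PrimeSpectrum.zeroLocus (l.head.asIdeal : Set S)) :=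
    { length := l.length
      toFun := fun i => ⟨l i, LTSeries.head_le l i⟩
      step := fun i => l.step i }
  have := Order.LTSeries.length_le_krullDim l'
  rw [← hl]; exact this

theorem cmfs_quot_list {R : Type*} [CommRing R] [IsLocalRing R] [IsNoetherianRing R] (p : Ideal R)
    [IsLocalRing (R ⧸ p)] (ys : List R)
    (h : p ⊔ Ideal.ofList ys = maximalIdeal R) :
    Ideal.ofList (ys.map (Ideal.Quotient.mk p)) = maximalIdeal (R ⧸ p) := by
  have hloc : IsLocalHom (Ideal.Quotient.mk p) :=
    IsLocalHom.of_surjective _ Ideal.Quotient.mk_surjective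
  have h1 : Ideal.map (Ideal.Quotient.mk p) (maximalIdeal R) = maximalIdeal (R ⧸ p) := by
    have hml : Ideal.map (Ideal.Quotient.mk p) (maximalIdeal R) ≤ maximalIdeal (R ⧸ p) :=
      ((IsLocalRing.local_hom_TFAE (Ideal.Quotient.mk p)).out 0 2).mp hloc
    have : (Ideal.map (Ideal.Quotient.mk p) (maximalIdeal R)).IsMaximal :=
      Ideal.map_eq_top_or_isMaximal_of_surjective _ Ideal.Quotient.mk_surjective
        (maximalIdeal.isMaximal R) |>.resolve_left (fun h => by
          rw [h] at hml; exact (maximalIdeal.isMaximal _).ne_top (top_le_iff.mp hml))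
    exact IsLocalRing.eq_maximalIdeal this
  rw [← Ideal.map_ofList, ← h1, ← h, Ideal.map_sup, Ideal.map_quotient_self, bot_sup_eq]

theorem cmfs_dim_le' {S : Type*} [CommRing S] [IsLocalRing S] [IsNoetherianRing S] (ys : List S)
    (hys : Ideal.ofList ys = maximalIdeal S) : ringKrullDim S ≤ ys.length := by
  refine cmfs_dim_le ys (fun y hy => hys ▸ Ideal.subset_span hy) ?_
  intro P hP hle
  rw [hys] at hle
  exact ((maximalIdeal.isMaximal S).eq_of_le hP.ne_top hle).symm

theorem cmfs_Lreg (n : ℕ) : ∀ {S : Type u} [CommRing S] [IsLocalRing S] [IsNoetherianRing S]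
    (xs : List S) (_ : xs.length = n) (_ : Ideal.ofList xs = maximalIdeal S)
    (_ : (n : WithBot ℕ∞) ≤ ringKrullDim S), IsDomain S ∧ IsWeaklyRegular S xs := by
  induction n with
  | zero =>
    intro S _ _ _ xs hlen hm _
    have : xs = [] := by simpa using hlen
    subst this
    refine ⟨?_, by simp⟩
    have : IsField S := IsLocalRing.isField_iff_maximalIdeal_eq.mpr (by simpa using hm.symm)
    exact this.isDomain
  | succ n ih =>
    intro S _ _ _ xs hlen hm hdim
    obtain _ | ⟨x, ys⟩ := xs
    · simp at hlen
    have hlen' : ys.length = n := by simpa using hlen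
    rw [Ideal.ofList_cons] at hm
    have hxm : x ∈ maximalIdeal S := hm ▸ Ideal.mem_sup_left (Ideal.mem_span_singleton_self x)
    have hle : Ideal.span {x} ≤ maximalIdeal S := (Ideal.span_singleton_le_iff_mem _).mpr hxm
    have : Nontrivial (S ⧸ Ideal.span {x}) := Ideal.Quotient.nontrivial_iff.mpr
      (fun h => by rw [h] at hle; exact (maximalIdeal.isMaximal S).ne_top (top_le_iff.mp hle))
    have : IsLocalRing (S ⧸ Ideal.span {x}) :=
      IsLocalRing.of_surjective' _ Ideal.Quotient.mk_surjective
    have hm' := cmfs_quot_list (Ideal.span {x}) ys hm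
    have hd' : (n : WithBot ℕ∞) ≤ ringKrullDim (S ⧸ Ideal.span {x}) := by
      have := ringKrullDim_le_ringKrullDim_quotient_add_encard {x}
        (by rw [IsLocalRing.ringJacobson_eq_maximalIdeal]; simpa using hxm)
      have := hdim.trans this
      rw [Set.encard_singleton] at this
      push_cast at this
      exact ENat.WithBot.add_le_add_one_right_iff.mp this
    obtain ⟨hdom, hreg⟩ := ih _ (by simpa using hlen') hm' hd'
    have hd'' := cmfs_dim_le' _ hm'
    rw [List.length_map, hlen'] at hd''
    obtain ⟨P, hPp, hPd⟩ := cmfs_exists_prime (n+1) hdim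
    have : IsLocalRing (S ⧸ P) := IsLocalRing.of_surjective' _ Ideal.Quotient.mk_surjective
    have hxP : x ∉ P := by
      intro hxP
      have h1 := cmfs_quot_list P ys (by
        apply le_antisymm
        · refine sup_le (IsLocalRing.le_maximalIdeal hPp.ne_top) ?_
          rw [← hm]; exact le_sup_right
        · rw [← hm]; exact sup_le_sup_right ((Ideal.span_singleton_le_iff_mem _).mpr hxP) _)
      have h2 := hPd.trans (cmfs_dim_le' _ h1)
      rw [List.length_map, hlen'] at h2
      have : n + 1 ≤ n := by exact_mod_cast h2
      omega
    have hPx : P ≤ Ideal.span {x} := by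
      intro a ha
      by_contra hax
      have hnz : (Ideal.Quotient.mk (Ideal.span {x}) a) ∈ nonZeroDivisors (S ⧸ Ideal.span {x}) := by
        rw [mem_nonZeroDivisors_iff_ne_zero]
        rwa [Ne, Ideal.Quotient.eq_zero_iff_mem]
      have h1 := ringKrullDim_quotient_succ_le_of_nonZeroDivisor hnz
      have h2 := ringKrullDim_le_ringKrullDim_quotient_add_encard {Ideal.Quotient.mk P x}
        (by
          rw [IsLocalRing.ringJacobson_eq_maximalIdeal, Set.singleton_subset_iff]
          have hloc : IsLocalHom (Ideal.Quotient.mk P) :=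
            IsLocalHom.of_surjective _ Ideal.Quotient.mk_surjective
          intro hu
          exact hxm ((isUnit_map_iff (Ideal.Quotient.mk P) x).mp hu))
      have h3 : ringKrullDim ((S ⧸ P) ⧸ Ideal.span {Ideal.Quotient.mk P x}) ≤
          ringKrullDim ((S ⧸ Ideal.span {x}) ⧸ Ideal.span {Ideal.Quotient.mk (Ideal.span {x}) a}) := by
        let φ0 : S →+* (S ⧸ P) ⧸ Ideal.span {Ideal.Quotient.mk P x} :=
          (Ideal.Quotient.mk _).comp (Ideal.Quotient.mk P)
        let φ1 : S ⧸ Ideal.span {x} →+* (S ⧸ P) ⧸ Ideal.span {Ideal.Quotient.mk P x} :=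
          Ideal.Quotient.lift _ φ0 (by
            intro b hb
            obtain ⟨c, rfl⟩ := Ideal.mem_span_singleton'.mp hb
            rw [map_mul]
            have : φ0 x = 0 := Ideal.Quotient.eq_zero_iff_mem.mpr (Ideal.mem_span_singleton_self _)
            rw [this, mul_zero])
        let φ : (S ⧸ Ideal.span {x}) ⧸ Ideal.span {Ideal.Quotient.mk (Ideal.span {x}) a} →+*
            (S ⧸ P) ⧸ Ideal.span {Ideal.Quotient.mk P x} :=
          Ideal.Quotient.lift _ φ1 (by
            intro b hb
            obtain ⟨c, rfl⟩ := Ideal.mem_span_singleton'.mp hb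
            rw [map_mul]
            have : φ1 (Ideal.Quotient.mk _ a) = 0 := by
              simp [φ1, φ0, Ideal.Quotient.eq_zero_iff_mem.mpr ha]
            rw [this, mul_zero])
        refine ringKrullDim_le_of_surjective φ ?_
        intro b
        obtain ⟨b, rfl⟩ := Ideal.Quotient.mk_surjective b
        obtain ⟨b, rfl⟩ := Ideal.Quotient.mk_surjective b
        exact ⟨Ideal.Quotient.mk _ (Ideal.Quotient.mk _ b), by simp [φ, φ1, φ0]⟩
      rw [Set.encard_singleton] at h2
      have h4 : ((n + 1 : ℕ) : WithBot ℕ∞) ≤ n := by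
        refine hPd.trans (h2.trans (le_trans ?_ (h1.trans hd'')))
        push_cast
        gcongr
      have : n + 1 ≤ n := by exact_mod_cast h4
      omega
    have hP0 : P = ⊥ := by
      refine Submodule.eq_bot_of_le_smul_of_le_jacobson_bot (Ideal.span {x}) P
        (IsNoetherian.noetherian P) ?_ (hle.trans (IsLocalRing.maximalIdeal_le_jacobson _))
      intro a ha
      obtain ⟨b, rfl⟩ := Ideal.mem_span_singleton'.mp (hPx ha)
      have hb := (hPp.mem_or_mem ha).resolve_right hxP
      rw [mul_comm]
      exact Submodule.smul_mem_smul (Ideal.mem_span_singleton_self x) hb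
    have hS : IsDomain S := by
      subst hP0
      exact (MulEquiv.isDomain_iff (RingEquiv.quotientBot S).toMulEquiv).mp inferInstance
    refine ⟨hS, ?_⟩
    have hx0 : x ≠ 0 := fun h => hxP (h ▸ P.zero_mem)
    rw [isWeaklyRegular_cons_iff]
    constructor
    · exact fun a b hab => mul_left_cancel₀ hx0 hab
    · have h1 := (isWeaklyRegular_map_algebraMap_iff (R := S) (S := S ⧸ Ideal.span {x})
        (M := S ⧸ Ideal.span {x}) ys).mp hreg
      have he : (Ideal.span {x} : Submodule S S) = x • (⊤ : Submodule S S) := by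
        rw [← Submodule.ideal_span_singleton_smul]; simp
      exact (LinearEquiv.isWeaklyRegular_congr (Submodule.quotEquivOfEq _ _ he) ys).mp h1

theorem cmfs_reg_exists {S : Type u} [CommRing S] [IsRegularLocalRing S] :
    ∃ xs : List S, (xs.length : WithBot ℕ∞) = ringKrullDim S ∧ Ideal.ofList xs = maximalIdeal S ∧
      IsRegular S xs := by
  have hfg : (maximalIdeal S).FG := IsNoetherian.noetherian _
  have hr : (maximalIdeal S).spanFinrank = ringKrullDim S := IsRegularLocalRing.spanFinrank_maximalIdeal
  have hc := Submodule.FG.generators_ncard hfg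
  have hfin := Submodule.FG.finite_generators hfg
  let xs := hfin.toFinset.toList
  have hlen : xs.length = (maximalIdeal S).spanFinrank := by
    rw [Finset.length_toList, ← Set.ncard_eq_toFinset_card _ hfin, hc]
  have hm : Ideal.ofList xs = maximalIdeal S := by
    have : Ideal.ofList xs = Ideal.span (maximalIdeal S).generators := by
      simp [Ideal.ofList, xs]
    rw [this]
    exact Submodule.span_generators _
  obtain ⟨_, hreg⟩ := cmfs_Lreg _ xs hlen hm hr.le
  refine ⟨xs, by rw [hlen, hr], hm, ?_⟩
  exact RingTheory.Sequence.IsRegular.of_isWeaklyRegular_of_mem_maximalIdeal S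
    (fun r hr => hm ▸ Ideal.subset_span hr) hreg

theorem cmfs_reg_sop {S : Type u} [CommRing S] [IsRegularLocalRing S] (ys : List S)
    (hys : ∀ y ∈ ys, y ∈ maximalIdeal S) (hlen : (ys.length : WithBot ℕ∞) = ringKrullDim S)
    (h : ∀ P : Ideal S, P.IsPrime → Ideal.ofList ys ≤ P → P = maximalIdeal S) :
    IsRegular S ys := by
  obtain ⟨xs, h1, h2, h3⟩ := cmfs_reg_exists (S := S)
  refine cmfs_L1 ys xs (fun r hr => h2 ▸ Ideal.subset_span hr) h3 ?_ hys (fun P hP _ => h P hP)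
  have := h1.trans hlen.symm
  exact_mod_cast this

section FlatMod
variable {S C : Type*} [CommRing S] [CommRing C] [Algebra S C]

def cmfsE (I : Ideal S) {ι : Type} [Fintype ι] (f : ι → S) : Submodule C (ι → C) where
  carrier := {c | ∑ i, algebraMap S C (f i) * c i ∈ I.map (algebraMap S C)}
  add_mem' := by
    intro a b ha hb
    simp only [Set.mem_ofPred_eq, Pi.add_apply, mul_add, Finset.sum_add_distrib] at *
    exact Ideal.add_mem _ ha hb
  zero_mem' := by simp
  smul_mem' := by
    intro a b hb
    simp only [Set.mem_ofPred_eq, Pi.smul_apply, smul_eq_mul, mul_left_comm _ a, ← Finset.mul_sum] at *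
    exact Ideal.mul_mem_left _ _ hb

def cmfsE' (I : Ideal S) {ι : Type} [Fintype ι] (f : ι → S) : Submodule C (ι → C) :=
  Submodule.span C {c | ∃ g : ι → S, ∑ i, f i * g i ∈ I ∧ c = fun i => algebraMap S C (g i)} ⊔
    Submodule.pi Set.univ (fun _ => (I.map (algebraMap S C) : Submodule C C))

variable (C) in
def cmfsFlatMod (I : Ideal S) : Prop := ∀ (ι : Type) [Fintype ι] (f : ι → S),
  cmfsE (C := C) I f ≤ cmfsE' I f

theorem cmfsE'_of_gen (I : Ideal S) {ι : Type} [Fintype ι] (f g : ι → S) (h : ∑ i, f i * g i ∈ I) :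
    (fun i => algebraMap S C (g i)) ∈ cmfsE' (C := C) I f :=
  Submodule.mem_sup_left (Submodule.subset_span ⟨g, h, rfl⟩)

theorem cmfsE'_of_pi (I : Ideal S) {ι : Type} [Fintype ι] (f : ι → S) (c : ι → C)
    (h : ∀ i, c i ∈ I.map (algebraMap S C)) : c ∈ cmfsE' (C := C) I f :=
  Submodule.mem_sup_right (fun i _ => h i)

theorem cmfsFlatMod_base [IsLocalRing S] : cmfsFlatMod C (maximalIdeal S) := by
  classical
  intro ι _ f c hc
  by_cases hall : ∀ i, f i ∈ maximalIdeal S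
  · have : c = ∑ i, c i • (fun j => algebraMap S C ((Pi.single i 1 : ι → S) j)) := by
      ext j
      simp [Finset.sum_apply, Pi.single_apply]
    rw [this]
    refine Submodule.sum_mem _ fun i _ => Submodule.smul_mem _ _ (cmfsE'_of_gen _ _ _ ?_)
    exact Ideal.sum_mem _ fun j _ => Ideal.mul_mem_right _ _ (hall j)
  · push Not at hall
    obtain ⟨i0, hi0⟩ := hall
    have hu : IsUnit (f i0) := by simpa using hi0
    obtain ⟨v, hv⟩ := hu.exists_right_inv
    have : c = ∑ i, c i • (fun j => algebraMap S C
        ((Pi.single i 1 - (f i * v) • Pi.single i0 1 : ι → S) j)) +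
        (fun j => (algebraMap S C v * ∑ i, algebraMap S C (f i) * c i) *
          algebraMap S C ((Pi.single i0 1 : ι → S) j)) := by
      ext j
      simp only [Pi.add_apply, Finset.sum_apply, Pi.smul_apply, smul_eq_mul, Pi.sub_apply, map_sub,
        mul_sub, Finset.sum_sub_distrib, map_mul]
      have h1 : ∑ x, c x * (algebraMap S C) ((Pi.single x 1 : ι → S) j) = c j := by
        simp [Pi.single_apply]
      rw [h1, Finset.mul_sum, Finset.sum_mul, sub_add, eq_comm, sub_eq_self, sub_eq_zero]
      exact Finset.sum_congr rfl fun x _ => by ring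
    rw [this]
    refine Submodule.add_mem _ (Submodule.sum_mem _ fun i _ => Submodule.smul_mem _ _
      (cmfsE'_of_gen _ _ _ ?_)) (cmfsE'_of_pi _ _ _ fun i => Ideal.mul_mem_right _ _
        (Ideal.mul_mem_left _ _ hc))
    have : ∑ j, f j * (Pi.single i 1 - (f i * v) • Pi.single i0 1 : ι → S) j = 0 := by
      simp only [Pi.sub_apply, mul_sub, Finset.sum_sub_distrib, Pi.smul_apply, smul_eq_mul]
      simp only [Pi.single_apply, mul_ite, mul_one, mul_zero, Finset.sum_ite_eq', Finset.mem_univ,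
        if_true]
      linear_combination (- f i) * hv
    rw [this]; exact Ideal.zero_mem _

theorem cmfsFlatMod_step [IsNoetherianRing S] [IsNoetherianRing C] (I : Ideal S) (x : S)
    (hxJ : algebraMap S C x ∈ Ideal.jacobson (⊥ : Ideal C))
    (hx : ∀ c : C, algebraMap S C x * c ∈ I.map (algebraMap S C) → c ∈ I.map (algebraMap S C))
    (hflat : cmfsFlatMod C (I ⊔ Ideal.span {x})) : cmfsFlatMod C I := by
  classical
  suffices h : ∀ (J : Ideal S) (ι : Type) [Fintype ι] (f : ι → S),
      Ideal.span (Set.range f) ⊔ I = J → cmfsE (C := C) I f ≤ cmfsE' I f from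
    fun ι _ f => h _ ι f rfl
  intro J
  induction J using WellFoundedGT.induction with
  | ind J ih =>
  intro ι _ f hJ
  set φ := algebraMap S C with hφ
  have hmapmem : ∀ a ∈ I, φ a ∈ I.map φ := fun a ha => Ideal.mem_map_of_mem φ ha
  refine Submodule.le_of_le_smul_of_le_jacobson_bot (I := Ideal.span {φ x})
    (IsNoetherian.noetherian _) ((Ideal.span_singleton_le_iff_mem _).mpr hxJ) ?_
  intro c hc
  have hc1 : c ∈ cmfsE (C := C) (I ⊔ Ideal.span {x}) f :=
    Ideal.map_mono le_sup_left hc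
  obtain ⟨s, hs, t, ht, rfl⟩ := Submodule.mem_sup.mp (hflat ι f hc1)
  obtain ⟨n, d, gg, rfl⟩ := (Submodule.mem_span_set' ).mp hs
  choose g hg hgg using fun j => (gg j).2
  have hh : ∀ j, ∃ i ∈ I, ∃ h : S, ∑ l, f l * g j l = i + x * h := by
    intro j
    obtain ⟨i, hi, y, hy, hiy⟩ := Submodule.mem_sup.mp (hg j)
    obtain ⟨h, rfl⟩ := Ideal.mem_span_singleton'.mp hy
    exact ⟨i, hi, h, by rw [← hiy, mul_comm]⟩
  choose ii hii h hh using hh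
  have ht' : ∀ l, ∃ ε ∈ I.map φ, ∃ e : C, t l = ε + φ x * e := by
    intro l
    have := ht l trivial
    rw [Ideal.map_sup, Ideal.map_span, Set.image_singleton] at this
    obtain ⟨i, hi, y, hy, hiy⟩ := Submodule.mem_sup.mp this
    obtain ⟨h, rfl⟩ := Ideal.mem_span_singleton'.mp hy
    exact ⟨i, hi, h, by rw [← hiy, mul_comm]⟩
  choose ε hε e he using ht'
  have hceq : (∑ j, d j • (gg j : ι → C)) + t =
      fun l => ∑ j, d j * φ (g j l) + (ε l + φ x * e l) := by
    ext l
    simp only [Pi.add_apply, Finset.sum_apply, Pi.smul_apply, smul_eq_mul, hgg, he]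
    rfl
  rw [hceq] at hc ⊢
  have hgφ : ∀ j, ∑ l, φ (f l) * φ (g j l) = φ (ii j) + φ x * φ (h j) := by
    intro j
    have := congrArg φ (hh j)
    simpa using this
  have hkey : ∑ j, d j * φ (h j) + ∑ l, φ (f l) * e l ∈ I.map φ := by
    apply hx
    have hc' : ∑ l, φ (f l) * (∑ j, d j * φ (g j l) + (ε l + φ x * e l)) ∈ I.map φ := hc
    have heq : ∑ l, φ (f l) * (∑ j, d j * φ (g j l) + (ε l + φ x * e l)) =
        φ x * (∑ j, d j * φ (h j) + ∑ l, φ (f l) * e l) + (∑ j, d j * φ (ii j) +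
          ∑ l, φ (f l) * ε l) := by
      have h1 : ∑ l, φ (f l) * ∑ j, d j * φ (g j l) =
          ∑ j, d j * (φ (ii j) + φ x * φ (h j)) := by
        simp only [← hgφ, Finset.mul_sum]
        rw [Finset.sum_comm]
        exact Finset.sum_congr rfl fun _ _ => Finset.sum_congr rfl fun _ _ => by ring
      simp only [mul_add, Finset.sum_add_distrib]
      rw [h1]
      simp only [mul_add, Finset.sum_add_distrib, Finset.mul_sum]
      have h2 : ∑ i, d i * (φ x * φ (h i)) = ∑ i, φ x * (d i * φ (h i)) :=
        Finset.sum_congr rfl fun _ _ => by ring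
      have h3 : ∑ i, φ (f i) * (φ x * e i) = ∑ i, φ x * (φ (f i) * e i) :=
        Finset.sum_congr rfl fun _ _ => by ring
      rw [h2, h3]; ring
    rw [heq] at hc'
    refine (Ideal.add_mem_iff_left _ ?_).mp hc'
    exact Ideal.add_mem _ (Ideal.sum_mem _ fun j _ => Ideal.mul_mem_left _ _ (hmapmem _ (hii j)))
      (Ideal.sum_mem _ fun j _ => Ideal.mul_mem_left _ _ (hε j))
  by_cases hall : ∀ j, h j ∈ J
  · have : ∀ j, ∃ g' : ι → S, ∃ i' ∈ I, h j = ∑ l, f l * g' l + i' := by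
      intro j
      have := hall j
      rw [← hJ] at this
      obtain ⟨y, hy, i', hi', hyi⟩ := Submodule.mem_sup.mp this
      obtain ⟨g', rfl⟩ := Ideal.mem_span_range_iff_exists_fun.mp hy
      exact ⟨g', i', hi', by rw [← hyi]; simp [mul_comm]⟩
    choose g' i' hi' hg' using this
    have hdec : (fun l => ∑ j, d j * φ (g j l) + (ε l + φ x * e l)) =
        (∑ j, d j • (fun l => φ (g j l - x * g' j l)) + ε) +
          φ x • (fun l => e l + ∑ j, d j * φ (g' j l)) := by
      ext l
      simp only [Pi.add_apply, Finset.sum_apply, Pi.smul_apply, smul_eq_mul, map_sub, map_mul,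
        mul_sub, Finset.sum_sub_distrib, mul_add, Finset.mul_sum]
      have h2 : ∑ i, d i * (φ x * φ (g' i l)) = ∑ i, φ x * (d i * φ (g' i l)) :=
        Finset.sum_congr rfl fun _ _ => by ring
      rw [h2]; ring
    rw [hdec]
    refine Submodule.add_mem_sup (Submodule.add_mem _ (Submodule.sum_mem _ fun j _ =>
      Submodule.smul_mem _ _ (cmfsE'_of_gen _ _ _ ?_)) (cmfsE'_of_pi _ _ _ hε))
      (Submodule.smul_mem_smul (Ideal.mem_span_singleton_self _) ?_)
    · have : ∑ l, f l * (g j l - x * g' j l) = ii j + x * i' j := by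
        have h1 : ∑ l, f l * (g j l - x * g' j l) = ∑ l, f l * g j l - x * ∑ l, f l * g' j l := by
          rw [Finset.mul_sum, ← Finset.sum_sub_distrib]
          exact Finset.sum_congr rfl fun _ _ => by ring
        rw [h1, hh, hg']; ring
      rw [this]
      exact Ideal.add_mem _ (hii j) (Ideal.mul_mem_left _ _ (hi' j))
    · change ∑ l, φ (f l) * (e l + ∑ j, d j * φ (g' j l)) ∈ I.map φ
      have h1 : ∀ j, ∑ l, φ (f l) * φ (g' j l) = φ (h j) - φ (i' j) := by
        intro j
        have := congrArg φ (hg' j)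
        simp only [map_add, map_sum, map_mul] at this
        rw [this]; ring
      have : ∑ l, φ (f l) * (e l + ∑ j, d j * φ (g' j l)) =
          (∑ j, d j * φ (h j) + ∑ l, φ (f l) * e l) - ∑ j, d j * φ (i' j) := by
        have h2 : ∑ l, φ (f l) * ∑ j, d j * φ (g' j l) =
            ∑ j, d j * (φ (h j) - φ (i' j)) := by
          simp only [← h1, Finset.mul_sum]
          rw [Finset.sum_comm]
          exact Finset.sum_congr rfl fun _ _ => Finset.sum_congr rfl fun _ _ => by ring
        simp only [mul_add, Finset.sum_add_distrib]
        rw [h2]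
        simp only [mul_sub, Finset.sum_sub_distrib]
        ring
      rw [this]
      exact Ideal.sub_mem _ hkey (Ideal.sum_mem _ fun j _ =>
        Ideal.mul_mem_left _ _ (hmapmem _ (hi' j)))
  · push Not at hall
    obtain ⟨j0, hj0⟩ := hall
    apply Submodule.mem_sup_left
    let F : Fin n ⊕ ι → S := Sum.elim h f
    have hlt : J < Ideal.span (Set.range F) ⊔ I := by
      refine lt_of_le_of_ne ?_ ?_
      · rw [← hJ]
        refine sup_le_sup_right (Ideal.span_mono ?_) _
        rintro _ ⟨l, rfl⟩
        exact ⟨Sum.inr l, rfl⟩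
      · intro heq
        apply hj0
        rw [heq]
        exact Ideal.mem_sup_left (Ideal.subset_span ⟨Sum.inl j0, rfl⟩)
    have hih := ih _ hlt (Fin n ⊕ ι) F rfl
    have hmem : (Sum.elim d e : Fin n ⊕ ι → C) ∈ cmfsE (C := C) I F := by
      change ∑ i, φ (F i) * (Sum.elim d e : Fin n ⊕ ι → C) i ∈ I.map φ
      rw [Fintype.sum_sum_type]
      simp only [F, Sum.elim_inl, Sum.elim_inr]
      simpa only [mul_comm (d _)] using hkey
    have hmem' := hih hmem
    let Φ : (Fin n ⊕ ι → C) →ₗ[C] (ι → C) :=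
      { toFun := fun u l => ∑ j, u (Sum.inl j) * φ (g j l) + φ x * u (Sum.inr l)
        map_add' := by
          intro u v; ext l
          simp only [Pi.add_apply, add_mul, mul_add, Finset.sum_add_distrib]; ring
        map_smul' := by
          intro a u; ext l
          simp only [Pi.smul_apply, smul_eq_mul, RingHom.id_apply, mul_add, Finset.mul_sum,
            mul_assoc]
          ring }
    have hΦ : cmfsE' (C := C) I F ≤ (cmfsE' (C := C) I f).comap Φ := by
      refine sup_le (Submodule.span_le.mpr ?_) ?_
      · rintro _ ⟨G, hG, rfl⟩
        rw [Fintype.sum_sum_type] at hG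
        simp only [F, Sum.elim_inl, Sum.elim_inr] at hG
        have : Φ (fun i => φ (G i)) =
            fun l => φ (∑ j, G (Sum.inl j) * g j l + x * G (Sum.inr l)) := by
          ext l; simp [Φ]
        change Φ (fun i => φ (G i)) ∈ cmfsE' (C := C) I f
        rw [this]
        refine cmfsE'_of_gen _ _ _ ?_
        have : ∑ l, f l * (∑ j, G (Sum.inl j) * g j l + x * G (Sum.inr l)) =
            ∑ j, G (Sum.inl j) * ii j + x * (∑ j, h j * G (Sum.inl j) + ∑ l, f l * G (Sum.inr l)) := by
          have h1 : ∑ l, f l * ∑ j, G (Sum.inl j) * g j l =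
              ∑ j, G (Sum.inl j) * (ii j + x * h j) := by
            simp only [← hh, Finset.mul_sum]
            rw [Finset.sum_comm]
            exact Finset.sum_congr rfl fun _ _ => Finset.sum_congr rfl fun _ _ => by ring
          simp only [mul_add, Finset.sum_add_distrib]
          rw [h1]
          simp only [mul_add, Finset.sum_add_distrib, Finset.mul_sum, add_assoc]
          congr 1
          congr 1
          · exact Finset.sum_congr rfl fun _ _ => by ring
          · exact Finset.sum_congr rfl fun _ _ => by ring
        rw [this]
        exact Ideal.add_mem _ (Ideal.sum_mem _ fun j _ => Ideal.mul_mem_left _ _ (hii j))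
          (Ideal.mul_mem_left _ _ hG)
      · intro u hu
        refine cmfsE'_of_pi _ _ _ fun l => ?_
        exact Ideal.add_mem _ (Ideal.sum_mem _ fun j _ => Ideal.mul_mem_right _ _ (hu _ trivial))
          (Ideal.mul_mem_left _ _ (hu _ trivial))
    have h1 := hΦ hmem'
    have : (fun l => ∑ j, d j * φ (g j l) + (ε l + φ x * e l)) = Φ (Sum.elim d e) + ε := by
      ext l; simp [Φ]; ring
    rw [this]
    exact Submodule.add_mem _ h1 (cmfsE'_of_pi _ _ _ hε)

theorem cmfsFlat_of_flatMod (h : cmfsFlatMod C (⊥ : Ideal S)) : Module.Flat S C := by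
  refine Module.Flat.of_forall_isTrivialRelation ?_
  intro l f c hfc
  have hc : c ∈ cmfsE (C := C) (⊥ : Ideal S) f := by
    change ∑ i, algebraMap S C (f i) * c i ∈ Ideal.map (algebraMap S C) ⊥
    simp only [Algebra.smul_def] at hfc
    rw [hfc]; exact Ideal.zero_mem _
  have := h (Fin l) f hc
  obtain ⟨s, hs, t, ht, rfl⟩ := Submodule.mem_sup.mp this
  have ht0 : t = 0 := by
    ext i
    have := ht i trivial
    rw [Ideal.map_bot] at this
    simpa using this
  subst ht0
  rw [add_zero]
  obtain ⟨n, d, gg, rfl⟩ := (Submodule.mem_span_set' ).mp hs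
  choose g hg hgg using fun j => (gg j).2
  refine ⟨n, fun i j => g j i, d, ?_, ?_⟩
  · intro i
    simp [Finset.sum_apply, hgg, Algebra.smul_def, mul_comm]
  · intro j
    simpa using hg j

theorem cmfs_L2 [IsLocalRing S] [IsNoetherianRing S] [IsLocalRing C] [IsNoetherianRing C]
    [IsLocalHom (algebraMap S C)]
    (xs : List S) (hxs : Ideal.ofList xs = maximalIdeal S)
    (hreg : IsWeaklyRegular C (xs.map (algebraMap S C))) : Module.Flat S C := by
  have key : ∀ k ≤ xs.length, cmfsFlatMod C (Ideal.ofList (xs.take (xs.length - k))) := by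
    intro k
    induction k with
    | zero =>
      intro _
      simp only [Nat.sub_zero, List.take_length, hxs]
      exact cmfsFlatMod_base
    | succ k ih =>
      intro hk
      have hi : xs.length - (k + 1) < xs.length := by omega
      refine cmfsFlatMod_step _ xs[xs.length - (k+1)] ?_ ?_ ?_
      · refine IsLocalRing.maximalIdeal_le_jacobson _ ?_
        have : xs[xs.length - (k+1)] ∈ maximalIdeal S := hxs ▸ Ideal.subset_span (List.getElem_mem _)
        intro hu
        exact this ((isUnit_map_iff (algebraMap S C) _).mp hu)
      · have h1 := hreg.regular_mod_prev (xs.length - (k+1)) (by simpa using hi)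
        intro c hc
        simp only [List.getElem_map] at h1
        have he : Ideal.ofList (List.take (xs.length - (k + 1)) (List.map (algebraMap S C) xs)) •
            (⊤ : Submodule C C) =
            Ideal.map (algebraMap S C) (Ideal.ofList (xs.take (xs.length - (k+1)))) := by
          rw [Ideal.map_ofList, List.map_take, smul_eq_mul, Ideal.mul_top]
        rw [← he]
        rw [← he] at hc
        have h3 := h1.right_eq_zero_of_smul (x := Submodule.Quotient.mk c) (by
          rw [← Submodule.Quotient.mk_smul, Submodule.Quotient.mk_eq_zero]
          exact hc)
        exact (Submodule.Quotient.mk_eq_zero _).mp h3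
      · have := ih (by omega)
        have he : xs.length - k = xs.length - (k+1) + 1 := by omega
        rw [he, List.take_add_one, Ideal.ofList_append] at this
        simpa [List.getElem?_eq_getElem hi] using this
  have := key xs.length le_rfl
  simp only [Nat.sub_self, List.take_zero, Ideal.ofList_nil] at this
  exact cmfsFlat_of_flatMod this

end FlatMod

theorem cmfs_L3 {B A : Type*} [CommRing B] [CommRing A] [Algebra B A] [IsNoetherianRing B]
    [IsNoetherianRing A]
    [Module.Finite B A] [IsDomain B] [IsIntegrallyClosed B] (Q P : Ideal A) [Q.IsPrime] [P.IsPrime]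
    (hPQ : P ≤ Q) (hP : P.comap (algebraMap B A) = ⊥) :
    Q.height = (Q.comap (algebraMap B A)).height := by
  have hintegral : Algebra.IsIntegral B A := inferInstance
  apply le_antisymm
  · have hm : StrictMono (PrimeSpectrum.comap (algebraMap B A)) := by
      intro I J hIJ
      exact Ideal.IsIntegral.comap_lt_comap (R := B) (I := I.asIdeal) (J := J.asIdeal) hIJ
    have := Order.height_le_height_apply_of_strictMono _ hm (⟨Q, inferInstance⟩ : PrimeSpectrum A)
    rw [← PrimeSpectrum.height_eq_orderHeight, ← PrimeSpectrum.height_eq_orderHeight] at this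
    exact this
  · have hinj : Function.Injective (algebraMap B (A ⧸ P)) := by
      rw [injective_iff_map_eq_zero]
      intro b hb
      rw [IsScalarTower.algebraMap_apply B A (A ⧸ P)] at hb
      have : algebraMap B A b ∈ P := Ideal.Quotient.eq_zero_iff_mem.mp hb
      rw [← Ideal.mem_comap] at this
      rw [hP] at this; simpa using this
    have : FaithfulSMul B (A ⧸ P) := (faithfulSMul_iff_algebraMap_injective _ _).mpr hinj
    have : Algebra.HasGoingDown B (A ⧸ P) := inferInstance
    let Q' := Q.map (Ideal.Quotient.mk P)
    have hQ'p : Q'.IsPrime := Ideal.map_isPrime_of_surjective Ideal.Quotient.mk_surjective (by simpa using hPQ)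
    have hQ' : Q'.comap (Ideal.Quotient.mk P) = Q := by
      rw [Ideal.comap_map_of_surjective _ Ideal.Quotient.mk_surjective]
      rw [← RingHom.ker_eq_comap_bot, Ideal.mk_ker, sup_eq_left]; exact hPQ
    have hlo : Q'.LiesOver (Q.comap (algebraMap B A)) := ⟨by
      conv_lhs => rw [← hQ']
      rfl⟩
    have h1 := Ideal.height_eq_height_add_of_liesOver_of_hasGoingDown (Q.comap (algebraMap B A)) Q'
    have h2 : (Q.comap (algebraMap B A)).height ≤ Q'.height := h1 ▸ le_self_add
    refine h2.trans ?_
    have hm : StrictMono (PrimeSpectrum.comap (Ideal.Quotient.mk P)) :=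
      RingHom.strictMono_comap_of_surjective Ideal.Quotient.mk_surjective
    have := Order.height_le_height_apply_of_strictMono _ hm (⟨Q', inferInstance⟩ : PrimeSpectrum (A ⧸ P))
    have he : PrimeSpectrum.comap (Ideal.Quotient.mk P) ⟨Q', inferInstance⟩ = ⟨Q, inferInstance⟩ := by
      ext1; exact hQ'
    rw [he, ← PrimeSpectrum.height_eq_orderHeight, ← PrimeSpectrum.height_eq_orderHeight] at this
    exact this

theorem cmfs_L4 {B A R : Type*} [CommRing B] [CommRing A] [CommRing R]
    [Algebra B A] [Algebra A R] [Algebra B R] [IsScalarTower B A R]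
    [IsNoetherianRing A] [IsNoetherianRing R]
    [Module.Finite B A] [IsDomain B] [IsIntegrallyClosed B] [IsRegularRing B]
    (M : Submonoid A) [IsLocalization M R]
    (Q P : Ideal R) [Q.IsPrime] [P.IsPrime]
    (hPQ : P ≤ Q) (hP : P.comap (algebraMap B R) = ⊥)
    (hCM : IsCohenMacaulayLocalRing (Localization.AtPrime Q)) :
    Module.Flat B (Localization.AtPrime Q) := by
  let q := Q.comap (algebraMap B R)
  let S := Localization.AtPrime q
  let C := Localization.AtPrime Q
  have hregS : IsRegularLocalRing S := isRegularRing_iff.mp inferInstance q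
  let ψ : S →+* C := Localization.localRingHom q Q (algebraMap B R) rfl
  let _ : Algebra S C := ψ.toAlgebra
  have hST : IsScalarTower B S C := IsScalarTower.of_algebraMap_eq (fun b => by
    change _ = ψ (algebraMap B S b)
    rw [Localization.localRingHom_to_map, ← IsScalarTower.algebraMap_apply])
  have hloc : IsLocalHom (algebraMap S C) := Localization.isLocalHom_localRingHom q Q (algebraMap B R) rfl
  obtain ⟨xs, hlen, hxm, hxreg⟩ := cmfs_reg_exists (S := S)
  obtain ⟨rs, hrm, hrreg, hrlen⟩ := hCM
  have hdim : ringKrullDim C = ringKrullDim S := by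
    rw [IsLocalization.AtPrime.ringKrullDim_eq_height Q C, IsLocalization.AtPrime.ringKrullDim_eq_height q S]
    rw [← IsLocalization.height_under M Q]
    have h3 := cmfs_L3 (B := B) (Q.under A) (P.under A) (Ideal.comap_mono hPQ) (by
      rw [← hP, Ideal.under, Ideal.comap_comap, IsScalarTower.algebraMap_eq B A R])
    rw [h3]
    congr 2
    rw [Ideal.under, Ideal.comap_comap, ← IsScalarTower.algebraMap_eq B A R]
  have hflat : Module.Flat S C := by
    refine cmfs_L2 xs hxm ?_
    have hC : IsRegular C (xs.map (algebraMap S C)) := by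
      refine cmfs_L1 _ rs hrm hrreg ?_ ?_ ?_
      · rw [List.length_map]
        have : (rs.length : WithBot ℕ∞) = xs.length := by
          rw [hlen, ← hdim]; exact hrlen
        exact_mod_cast this
      · intro y hy
        obtain ⟨x, hx, rfl⟩ := List.mem_map.mp hy
        have hx' : x ∈ maximalIdeal S := hxm ▸ Ideal.subset_span hx
        intro hu
        exact hx' ((isUnit_map_iff (algebraMap S C) _).mp hu)
      · intro 𝔓 h𝔓 _ hle
        rw [← Ideal.map_ofList, Ideal.map_le_iff_le_comap, hxm] at hle
        have hS : 𝔓.comap (algebraMap S C) = maximalIdeal S :=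
          ((maximalIdeal.isMaximal S).eq_of_le (Ideal.IsPrime.comap _).ne_top hle).symm
        have hB : 𝔓.comap (algebraMap B C) = q := by
          rw [IsScalarTower.algebraMap_eq B S C, ← Ideal.comap_comap, hS]
          exact Localization.AtPrime.under_maximalIdeal
        have hmC : (maximalIdeal C).comap (algebraMap R C) = Q :=
          Localization.AtPrime.under_maximalIdeal
        have hle' : 𝔓 ≤ maximalIdeal C := IsLocalRing.le_maximalIdeal h𝔓.ne_top
        have hA : (𝔓.comap (algebraMap R C)).comap (algebraMap A R) =
            ((maximalIdeal C).comap (algebraMap R C)).comap (algebraMap A R) := by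
          by_contra hne
          have hlt := lt_of_le_of_ne (Ideal.comap_mono (f := algebraMap A R)
            (Ideal.comap_mono (f := algebraMap R C) hle')) hne
          have := Ideal.IsIntegral.comap_lt_comap (R := B) hlt
          rw [hmC] at this
          simp only [Ideal.comap_comap, ← IsScalarTower.algebraMap_eq B A R,
            ← IsScalarTower.algebraMap_eq B R C] at this
          rw [RingHom.comp_assoc, ← IsScalarTower.algebraMap_eq B A R,
            ← IsScalarTower.algebraMap_eq B R C, hB] at this
          exact lt_irrefl _ this
        have h1 : (⟨𝔓.comap (algebraMap R C), inferInstance⟩ : PrimeSpectrum R) =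
            ⟨(maximalIdeal C).comap (algebraMap R C), inferInstance⟩ :=
          PrimeSpectrum.localization_comap_injective R M (by ext1; exact hA)
        have h2 : (⟨𝔓, inferInstance⟩ : PrimeSpectrum C) = ⟨maximalIdeal C, inferInstance⟩ :=
          PrimeSpectrum.localization_comap_injective C Q.primeCompl (by
            ext1; exact congrArg PrimeSpectrum.asIdeal h1)
        exact congrArg PrimeSpectrum.asIdeal h2
    exact hC.toIsWeaklyRegular
  have : Module.Flat B S := IsLocalization.flat S q.primeCompl
  exact Module.Flat.trans B S C

theorem cmfs_cm_equiv {R S : Type*} [CommRing R] [CommRing S] [IsLocalRing R] [IsLocalRing S]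
    (e : R ≃+* S) (h : IsCohenMacaulayLocalRing R) : IsCohenMacaulayLocalRing S := by
  obtain ⟨rs, hm, hr, hl⟩ := h
  refine ⟨rs.map e, ?_, ?_, ?_⟩
  · intro y hy
    obtain ⟨x, hx, rfl⟩ := List.mem_map.mp hy
    intro hu
    exact hm x hx ((MulEquiv.isUnit_map e).mp hu)
  · refine (AddEquiv.isRegular_congr (e := e.toAddEquiv) (as := rs) (bs := rs.map e) ?_).mp hr
    rw [List.forall₂_map_right_iff, List.forall₂_same]
    intro x hx y
    simp
  · rw [List.length_map, hl]
    exact ringKrullDim_eq_of_ringEquiv e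

theorem cmfs_cm_loc {R : Type*} [CommRing R] (f : R)
    (hRf : IsCohenMacaulayRing (Localization.Away f)) (Q : Ideal R) [hQ : Q.IsPrime] (hfQ : f ∉ Q) :
    IsCohenMacaulayLocalRing (Localization.AtPrime Q) := by
  have hdis : Disjoint (Submonoid.powers f : Set R) (Q : Set R) := by
    rw [Set.disjoint_left]
    rintro _ ⟨n, rfl⟩ h
    exact hfQ (hQ.mem_of_pow_mem n h)
  let Q' := Q.map (algebraMap R (Localization.Away f))
  have hQ' : Q'.IsPrime := IsLocalization.isPrime_of_isPrime_disjoint (Submonoid.powers f) _ Q hQ hdis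
  have hc : Q'.comap (algebraMap R (Localization.Away f)) = Q :=
    IsLocalization.under_map_of_isPrime_disjoint (Submonoid.powers f) _ hQ hdis
  have h := hRf Q' hQ'
  have h1 : IsLocalization.AtPrime (Localization.AtPrime Q') (Q'.comap (algebraMap R (Localization.Away f))) :=
    IsLocalization.isLocalization_atPrime_localization_atPrime (Submonoid.powers f) Q'
  have h2 : IsLocalization.AtPrime (Localization.AtPrime Q') Q := by
    simpa only [hc] using h1
  exact cmfs_cm_equiv (IsLocalization.algEquiv Q.primeCompl (Localization.AtPrime Q') (Localization.AtPrime Q)).toRingEquiv h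

/-- The exponents `1 + p + ⋯ + p^(e-1)`. -/
def cmfsC (p : ℕ) : ℕ → ℕ
  | 0 => 0
  | e + 1 => p * cmfsC p e + 1

theorem cmfs_C_ge (p : ℕ) (hp : p.Prime) (e : ℕ) : e ≤ cmfsC p e := by
  induction e with
  | zero => simp
  | succ e ih =>
    have := hp.pos
    simp only [cmfsC]
    nlinarith

section theta
variable {R : Type*} [CommRing R] {p : ℕ} {f : R} {θ : R → R}

theorem cmfs_theta_f (hθ_lin : ∀ a b : R, θ (a ^ p * b) = a * θ b) (hθ_f : θ f = 1) (e : ℕ) :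
    θ^[e] (f ^ cmfsC p e) = 1 := by
  induction e with
  | zero => simp [cmfsC]
  | succ e ih =>
    rw [Function.iterate_succ_apply]
    have : f ^ cmfsC p (e + 1) = (f ^ cmfsC p e) ^ p * f := by
      simp only [cmfsC]; ring
    rw [this, hθ_lin, hθ_f, mul_one, ih]

theorem cmfs_theta_lin (hθ_lin : ∀ a b : R, θ (a ^ p * b) = a * θ b) (e : ℕ) (a b : R) :
    θ^[e] (a ^ p ^ e * b) = a * θ^[e] b := by
  induction e generalizing b with
  | zero => simp
  | succ e ih =>
    rw [Function.iterate_succ_apply, Function.iterate_succ_apply, pow_succ, pow_mul, hθ_lin, ih]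

theorem cmfs_theta_add (hθ_add : ∀ a b : R, θ (a + b) = θ a + θ b) (e : ℕ) (a b : R) :
    θ^[e] (a + b) = θ^[e] a + θ^[e] b := by
  induction e generalizing a b with
  | zero => simp
  | succ e ih => simp only [Function.iterate_succ_apply, hθ_add, ih]

theorem cmfs_theta_zero (hθ_add : ∀ a b : R, θ (a + b) = θ a + θ b) : θ 0 = 0 := by
  have := hθ_add 0 0
  simpa using this

theorem cmfs_theta_span (hθ_add : ∀ a b : R, θ (a + b) = θ a + θ b)
    (hθ_lin : ∀ a b : R, θ (a ^ p * b) = a * θ b) (hθ_f : θ f = 1) (e N : ℕ) (hN : N ≤ cmfsC p e)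
    (s : Set R) (r : R) (h : f ^ N * r ^ p ^ e ∈ Ideal.span ((fun x => x ^ p ^ e) '' s)) :
    r ∈ Ideal.span s := by
  have h1 : r ^ p ^ e * f ^ cmfsC p e ∈ Ideal.span ((fun x => x ^ p ^ e) '' s) := by
    obtain ⟨j, hj⟩ := Nat.exists_eq_add_of_le hN
    rw [hj, pow_add]
    have := Ideal.mul_mem_left _ (f ^ j) h
    convert this using 1
    ring
  have h2 : ∀ z ∈ Ideal.span ((fun x => x ^ p ^ e) '' s), ∀ c, θ^[e] (z * c) ∈ Ideal.span s := by
    intro z hz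
    induction hz using Submodule.span_induction with
    | mem x hx =>
      obtain ⟨y, hy, rfl⟩ := hx
      intro c
      have := cmfs_theta_lin hθ_lin e y c
      simp only [this]
      exact Ideal.mul_mem_right _ _ (Ideal.subset_span hy)
    | zero =>
      intro c
      rw [zero_mul, Function.iterate_fixed (cmfs_theta_zero hθ_add)]
      exact zero_mem _
    | add x y _ _ hx hy =>
      intro c
      rw [add_mul, cmfs_theta_add hθ_add]
      exact add_mem (hx c) (hy c)
    | smul a x hx' hx =>
      intro c
      rw [smul_eq_mul, mul_comm a x, mul_assoc]
      exact hx _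
  have := h2 _ h1 1
  rwa [mul_one, cmfs_theta_lin hθ_lin, cmfs_theta_f hθ_lin hθ_f, mul_one] at this

theorem cmfs_reduced (hp : p.Prime) (hθ_add : ∀ a b : R, θ (a + b) = θ a + θ b)
    (hθ_lin : ∀ a b : R, θ (a ^ p * b) = a * θ b) (hθ_f : θ f = 1) : IsReduced R := by
  constructor
  rintro x ⟨n, hn⟩
  have h1 : x ^ p ^ n = 0 := pow_eq_zero_of_le (Nat.lt_pow_self hp.one_lt).le hn
  have := cmfs_theta_lin hθ_lin n x (f ^ cmfsC p n)
  rw [cmfs_theta_f hθ_lin hθ_f, h1, zero_mul, Function.iterate_fixed (cmfs_theta_zero hθ_add)] at this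
  simpa using this.symm

theorem cmfs_min_ann [IsReduced R] (Q : Ideal R)
    (hQ : Q ∈ minimalPrimes R) (x : R) (hx : x ∈ Q) : ∃ s ∉ Q, s * x = 0 := by
  have hprime : Q.IsPrime := hQ.1.1
  have h1 := IsLocalization.AtPrime.radical_map_of_mem_minimalPrimes
    (A := Localization.AtPrime Q) Q ⊥ hQ
  have h2 : algebraMap R (Localization.AtPrime Q) x ∈ Q.map (algebraMap R (Localization.AtPrime Q)) :=
    Ideal.mem_map_of_mem _ hx
  rw [← h1, Ideal.map_bot] at h2
  have hred : IsReduced (Localization.AtPrime Q) :=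
    inferInstance
  obtain ⟨n, hn⟩ := h2
  have h3 : algebraMap R (Localization.AtPrime Q) x = 0 := hred.eq_zero _ ⟨n, by simpa using hn⟩
  rw [IsLocalization.map_eq_zero_iff Q.primeCompl] at h3
  obtain ⟨s, hs⟩ := h3
  exact ⟨s, s.2, hs⟩

theorem cmfs_min_stable (hp : p.Prime) (hθ_add : ∀ a b : R, θ (a + b) = θ a + θ b)
    (hθ_lin : ∀ a b : R, θ (a ^ p * b) = a * θ b) (hθ_f : θ f = 1) (Q : Ideal R)
    (hQ : Q ∈ minimalPrimes R) (x : R) (hx : x ∈ Q) : θ x ∈ Q := by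
  have := cmfs_reduced hp hθ_add hθ_lin hθ_f
  have hprime : Q.IsPrime := hQ.1.1
  obtain ⟨s, hs, hsx⟩ := cmfs_min_ann Q hQ x hx
  have h0 : s ^ p * x = 0 := by
    obtain ⟨q, hq⟩ := Nat.exists_eq_succ_of_ne_zero hp.ne_zero
    rw [hq, pow_succ, mul_assoc, hsx, mul_zero]
  have h1 := hθ_lin s x
  rw [h0, cmfs_theta_zero hθ_add] at h1
  exact (hprime.mem_or_mem (h1 ▸ zero_mem Q)).resolve_left hs

theorem cmfs_stable_one (hp : p.Prime) 
    (hθ_lin : ∀ a b : R, θ (a ^ p * b) = a * θ b) (hθ_f : θ f = 1) (J : Ideal R)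
    (hJ : ∀ x ∈ J, θ x ∈ J) (N : ℕ) (hN : f ^ N ∈ J) : (1 : R) ∈ J := by
  have h1 : f ^ cmfsC p N ∈ J := J.pow_mem_of_pow_mem hN (cmfs_C_ge p hp N)
  rw [← cmfs_theta_f hθ_lin hθ_f N]
  generalize f ^ cmfsC p N = z at h1
  generalize N = n
  induction n generalizing z with
  | zero => exact h1
  | succ n ih => exact ih _ (hJ _ h1)
end theta

section equidim
variable {B A R : Type*} [CommRing B] [CommRing A] [CommRing R]
    [Algebra B A] [Algebra A R] [Algebra B R] [IsScalarTower B A R]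
    [IsNoetherianRing A] [IsNoetherianRing R] [IsLocalRing R]
    [Module.Finite B A] [IsDomain B] [IsIntegrallyClosed B] [IsRegularRing B]

theorem cmfs_equidim 
    (M : Submonoid A) [IsLocalization M R] (hinj : Function.Injective (algebraMap B R))
    (f : R) (hRf : IsCohenMacaulayRing (Localization.Away f)) (p : ℕ) (hp : p.Prime)
    (θ : R → R)
    (hθ_add : ∀ a b : R, θ (a + b) = θ a + θ b)
    (hθ_lin : ∀ a b : R, θ (a ^ p * b) = a * θ b)
    (hθ_f : θ f = 1) (p2 : Ideal R) (hp2 : p2 ∈ minimalPrimes R) :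
    p2.comap (algebraMap B R) = ⊥ := by
  by_contra hbad
  have hred := cmfs_reduced hp hθ_add hθ_lin hθ_f
  let G := {P ∈ minimalPrimes R | P.comap (algebraMap B R) = ⊥}
  let H := {P ∈ minimalPrimes R | P.comap (algebraMap B R) ≠ ⊥}
  have hGne : ∃ p1, p1 ∈ G := by
    obtain ⟨p', hp', hc⟩ := Ideal.exists_comap_eq_of_mem_minimalPrimes_of_injective hinj ⊥ (by
      rw [IsDomain.minimalPrimes_eq_singleton_bot]; rfl)
    obtain ⟨q, hq, hle⟩ := Ideal.exists_minimalPrimes_le (I := ⊥) (J := p') bot_le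
    exact ⟨q, hq, le_bot_iff.mp (hc ▸ Ideal.comap_mono hle)⟩
  have hstab : ∀ (s : Set (Ideal R)), s ⊆ minimalPrimes R → ∀ x ∈ sInf s, θ x ∈ sInf s := by
    intro s hs x hx
    rw [Ideal.mem_sInf] at hx ⊢
    intro I hI
    exact cmfs_min_stable hp hθ_add hθ_lin hθ_f I (hs hI) x (hx hI)
  have hle : ∀ (s : Set (Ideal R)), s ⊆ minimalPrimes R → ∀ Q : Ideal R, Q.IsPrime → sInf s ≤ Q →
      ∃ P ∈ s, P ≤ Q := by
    intro s hs Q hQ h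
    have hfin := (minimalPrimes.finite_of_isNoetherianRing R).subset hs
    obtain ⟨P, hP, h⟩ := (hQ.inf_le' (s := hfin.toFinset) (f := id)).mp (by
      rwa [Finset.inf_id_eq_sInf, hfin.coe_toFinset])
    exact ⟨P, by simpa using hP, h⟩
  have hrad : f ∈ (sInf G ⊔ sInf H).radical := by
    rw [Ideal.radical_eq_sInf, Ideal.mem_sInf]
    rintro Q ⟨hQle, hQ⟩
    by_contra hfQ
    obtain ⟨P1, hP1, hP1Q⟩ := hle G (fun _ h => h.1) Q hQ (le_sup_left.trans hQle)
    obtain ⟨P2, hP2, hP2Q⟩ := hle H (fun _ h => h.1) Q hQ (le_sup_right.trans hQle)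
    have : P1.IsPrime := hP1.1.1.1
    have hP2p : P2.IsPrime := hP2.1.1.1
    have hflat := cmfs_L4 (B := B) M Q P1 hP1Q hP1.2 (cmfs_cm_loc f hRf Q hfQ)
    obtain ⟨b, hb, hb0⟩ := Submodule.exists_mem_ne_zero_of_ne_bot hP2.2
    obtain ⟨s, hs, hsb⟩ := cmfs_min_ann P2 hP2.1 _ hb
    have hreg : IsSMulRegular (Localization.AtPrime Q) b :=
      Module.Flat.isSMulRegular_of_nonZeroDivisors (mem_nonZeroDivisors_of_ne_zero hb0)
    have h0 : algebraMap R (Localization.AtPrime Q) s = 0 := by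
      apply hreg.right_eq_zero_of_smul
      rw [Algebra.smul_def, IsScalarTower.algebraMap_apply B R, ← map_mul, mul_comm, hsb, map_zero]
    rw [IsLocalization.map_eq_zero_iff Q.primeCompl] at h0
    obtain ⟨u, hu⟩ := h0
    have : (u : R) * s ∈ P2 := hu ▸ zero_mem _
    rcases hP2p.mem_or_mem this with h | h
    · exact u.2 (hP2Q h)
    · exact hs h
  obtain ⟨N, hN⟩ := hrad
  have h1 := cmfs_stable_one hp hθ_lin hθ_f (sInf G ⊔ sInf H) (by
    intro x hx
    obtain ⟨a, ha, b, hb, rfl⟩ := Submodule.mem_sup.mp hx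
    rw [hθ_add]
    exact Submodule.add_mem_sup (hstab G (fun _ h => h.1) a ha) (hstab H (fun _ h => h.1) b hb)) N hN
  obtain ⟨p1, hp1⟩ := hGne
  have : sInf G ⊔ sInf H ≤ maximalIdeal R :=
    sup_le ((sInf_le hp1).trans (IsLocalRing.le_maximalIdeal hp1.1.1.1.ne_top))
      ((sInf_le (show p2 ∈ H from ⟨hp2, hbad⟩)).trans (IsLocalRing.le_maximalIdeal hp2.1.1.ne_top))
  exact (maximalIdeal.isMaximal R).ne_top ((Ideal.eq_top_iff_one _).mpr (this h1))

theorem cmfs_flat 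
    (M : Submonoid A) [IsLocalization M R] (hinj : Function.Injective (algebraMap B R))
    (f : R) (hRf : IsCohenMacaulayRing (Localization.Away f)) (p : ℕ) (hp : p.Prime)
    (θ : R → R)
    (hθ_add : ∀ a b : R, θ (a + b) = θ a + θ b)
    (hθ_lin : ∀ a b : R, θ (a ^ p * b) = a * θ b)
    (hθ_f : θ f = 1) (Q : Ideal R) [Q.IsPrime] (hfQ : f ∉ Q) :
    Module.Flat B (Localization.AtPrime Q) := by
  obtain ⟨q, hq, hle⟩ := Ideal.exists_minimalPrimes_le (I := ⊥) (J := Q) bot_le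
  have : q.IsPrime := hq.1.1
  exact cmfs_L4 (B := B) M Q q hle (cmfs_equidim M hinj f hRf p hp θ hθ_add hθ_lin hθ_f q hq)
    (cmfs_cm_loc f hRf Q hfQ)
end equidim

section trace
variable (B A R : Type*) [CommRing B] [CommRing A] [CommRing R]
    [Algebra B A] [Algebra A R] [Algebra B R] [IsScalarTower B A R]

/-- Maps `A → R` factoring through a finite free `B`-module. -/
def cmfsW : Submodule R (A →ₗ[B] R) :=
  Submodule.span R (Set.range fun φ : A →ₗ[B] B => (Algebra.linearMap B R).comp φ)

/-- Elements of `R` such that multiplication by them factors through a finite free module. -/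
def cmfsT : Ideal R :=
  (cmfsW B A R).comap (LinearMap.toSpanSingleton R (A →ₗ[B] R) (IsScalarTower.toAlgHom B A R).toLinearMap)

variable {B A R}

theorem cmfs_colon [IsLocalRing R] (M : Submonoid A) [IsLocalization M R]
    (I : Ideal B) (y : B)
    (hy : ∀ b, y * b ∈ I → ∃ v, v ∉ (maximalIdeal R).comap (algebraMap B R) ∧ v * b ∈ I)
    (r : R) (hr : algebraMap B R y * r ∈ I.map (algebraMap B R)) (a : R) (ha : a ∈ cmfsT B A R) :
    a * r ∈ I.map (algebraMap B R) := by
  obtain ⟨⟨x, s⟩, hs⟩ := IsLocalization.surj M r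
  simp only at hs
  have h1 : algebraMap A R (algebraMap B A y * x) ∈ (I.map (algebraMap B A)).map (algebraMap A R) := by
    rw [Ideal.map_map, ← IsScalarTower.algebraMap_eq, map_mul, ← IsScalarTower.algebraMap_apply, ← hs,
      ← mul_assoc]
    exact Ideal.mul_mem_right _ _ hr
  rw [IsLocalization.algebraMap_mem_map_algebraMap_iff M] at h1
  obtain ⟨u, hu, h1⟩ := h1
  have h2 : ∀ g ∈ cmfsW B A R, g (u * x) ∈ I.map (algebraMap B R) := by
    intro g hg
    induction hg using Submodule.span_induction with
    | mem g hg =>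
      obtain ⟨φ, rfl⟩ := hg
      have h3 : ∀ z ∈ I.map (algebraMap B A), φ z ∈ I := by
        intro z hz
        have hz' : z ∈ I • (⊤ : Submodule B A) := by
          rw [Ideal.smul_top_eq_map]; exact hz
        refine Submodule.smul_induction_on hz' ?_ ?_
        · intro i hi n _
          rw [map_smul, smul_eq_mul]
          exact Ideal.mul_mem_right _ _ hi
        · intro z w hz hw
          rw [map_add]; exact add_mem hz hw
      have h4 := h3 _ h1
      have h5 : u * (algebraMap B A y * x) = y • (u * x) := by
        rw [Algebra.smul_def]; ring
      rw [h5, map_smul, smul_eq_mul] at h4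
      obtain ⟨v, hv, hvb⟩ := hy _ h4
      have hvu : IsUnit (algebraMap B R v) := by
        by_contra h
        exact hv h
      have h6 := Ideal.mem_map_of_mem (algebraMap B R) hvb
      rw [map_mul] at h6
      exact (Ideal.unit_mul_mem_iff_mem _ hvu).mp h6
    | zero => simp
    | add g h _ _ hg hh => exact add_mem hg hh
    | smul c g _ hg => exact Ideal.mul_mem_left _ c hg
  have h3 := h2 _ ha
  have h4 : a * algebraMap A R (u * x) ∈ I.map (algebraMap B R) := h3
  have hu' : IsUnit (algebraMap A R u) := IsLocalization.map_units R ⟨u, hu⟩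
  have hs' : IsUnit (algebraMap A R s) := IsLocalization.map_units R s
  rw [map_mul, ← hs] at h4
  have : a * (algebraMap A R u * (r * algebraMap A R s)) = 
      (algebraMap A R u * algebraMap A R s) * (a * r) := by ring
  rw [this] at h4
  exact (Ideal.unit_mul_mem_iff_mem _ (hu'.mul hs')).mp h4

theorem cmfs_T_not_le [IsNoetherianRing B] [Module.Finite B A] (Q : Ideal R) [hQ : Q.IsPrime]
    [Module.Flat B (Localization.AtPrime Q)] : ¬ cmfsT B A R ≤ Q := by
  classical
  intro hle
  let C := Localization.AtPrime Q
  have : Module.FinitePresentation B A := Module.finitePresentation_of_finite B A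
  obtain ⟨l, α, β, hαβ⟩ := Module.Flat.exists_factorization_of_finitePresentation
    (IsScalarTower.toAlgHom B A C).toLinearMap
  obtain ⟨t, ht⟩ := IsLocalization.exist_integer_multiples_of_finset Q.primeCompl
    (Finset.univ.image fun i => β (Finsupp.single i 1))
  have ht' : ∀ i, ∃ r : R, algebraMap R C r = (t : R) • β (Finsupp.single i 1) := by
    intro i
    exact ht _ (Finset.mem_image_of_mem _ (Finset.mem_univ i))
  choose r hr using ht'
  let φ (i : Fin l) : A →ₗ[B] B := (Finsupp.lapply i).comp α
  let h : A →ₗ[B] R := ∑ i, r i • (Algebra.linearMap B R).comp (φ i)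
  have hh : ∀ s : R, s • h ∈ cmfsW B A R := fun s => Submodule.smul_mem _ _
    (Submodule.sum_mem _ fun i _ => Submodule.smul_mem _ _ (Submodule.subset_span ⟨φ i, rfl⟩))
  have key : ∀ x : A, algebraMap R C ((t : R) * algebraMap A R x) = algebraMap R C (h x) := by
    intro x
    have h1 : algebraMap A C x = β (α x) := by
      have := LinearMap.congr_fun hαβ x
      exact this
    have h2 : β (α x) = ∑ i, φ i x • β (Finsupp.single i 1) := by
      conv_lhs => rw [← Finsupp.univ_sum_single (α x), map_sum]
      refine Finset.sum_congr rfl fun i _ => ?_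
      rw [← map_smul]
      simp [φ]
    rw [map_mul, ← IsScalarTower.algebraMap_apply, h1, h2, Finset.mul_sum]
    simp only [h, LinearMap.sum_apply, map_sum, LinearMap.smul_apply, LinearMap.comp_apply,
      smul_eq_mul, map_mul, hr, Algebra.linearMap_apply]
    refine Finset.sum_congr rfl fun i _ => ?_
    rw [← IsScalarTower.algebraMap_apply, Algebra.smul_def, Algebra.smul_def]
    ring
  have key2 : ∀ x : A, ∃ w : Q.primeCompl, (w : R) * ((t : R) * algebraMap A R x) = w * h x := by
    intro x
    exact (IsLocalization.eq_iff_exists Q.primeCompl C).mp (key x)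
  choose w hw using key2
  obtain ⟨S, hS⟩ := Module.Finite.fg_top (R := B) (M := A)
  let W : Q.primeCompl := ∏ x ∈ S, w x
  have hWt : (W : R) * t ∈ cmfsT B A R := by
    change ((W : R) * t) • (IsScalarTower.toAlgHom B A R).toLinearMap ∈ cmfsW B A R
    have : ((W : R) * t) • (IsScalarTower.toAlgHom B A R).toLinearMap = (W : R) • h := by
      refine LinearMap.ext_on hS ?_
      intro x hx
      obtain ⟨c, hc⟩ := Finset.dvd_prod_of_mem w hx
      change (W : R) * t * algebraMap A R x = W * h x
      have hc' : (W : R) = w x * c := congrArg Subtype.val hc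
      rw [hc']
      linear_combination (c : R) * hw x
    rw [this]; exact hh _
  exact (W * t).2 (hle hWt)

theorem cmfs_T_pow [IsNoetherianRing B] [Module.Finite B A] (f : R)
    (h : ∀ Q : Ideal R, ∀ _ : Q.IsPrime, f ∉ Q → Module.Flat B (Localization.AtPrime Q)) :
    ∃ N, f ^ N ∈ cmfsT B A R := by
  have : f ∈ (cmfsT B A R).radical := by
    rw [Ideal.radical_eq_sInf, Ideal.mem_sInf]
    rintro Q ⟨hQle, hQ⟩
    by_contra hfQ
    have := h Q hQ hfQ
    exact cmfs_T_not_le Q hQle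
  exact this
end trace

theorem cmfs_wreg_iff {R : Type*} [CommRing R] (rs : List R) :
    IsWeaklyRegular R rs ↔ ∀ (i : Fin rs.length) (x : R),
      rs[i] * x ∈ Ideal.ofList (rs.take i) → x ∈ Ideal.ofList (rs.take i) := by
  rw [isWeaklyRegular_iff_Fin]
  refine forall_congr' fun i => ?_
  rw [isSMulRegular_quotient_iff_mem_of_smul_mem]
  simp only [smul_eq_mul, Ideal.mul_top]

/-- powers of a system of parameters at a prime of a regular ring -/
theorem cmfs_B_colon {B : Type*} [CommRing B] [IsRegularRing B] (q : Ideal B) [hq : q.IsPrime]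
    (xs : List B) (hmin : q ∈ (Ideal.ofList xs).minimalPrimes) (hlen : (xs.length : ℕ∞) = q.height)
    (n : ℕ) (hn : n ≠ 0) (i : ℕ) (hi : i < xs.length) (b : B)
    (hb : xs[i] ^ n * b ∈ Ideal.ofList ((xs.map (· ^ n)).take i)) :
    ∃ v, v ∉ q ∧ v * b ∈ Ideal.ofList ((xs.map (· ^ n)).take i) := by
  let S := Localization.AtPrime q
  have hregS : IsRegularLocalRing S := isRegularRing_iff.mp inferInstance q
  let ys := xs.map (· ^ n)
  let zs := ys.map (algebraMap B S)
  have hxq : ∀ x ∈ xs, x ∈ q := fun x hx => hmin.1.2 (Ideal.subset_span hx)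
  have hreg : IsRegular S zs := by
    refine cmfs_reg_sop zs ?_ ?_ ?_
    · intro z hz
      obtain ⟨y, hy, rfl⟩ := List.mem_map.mp hz
      obtain ⟨x, hx, rfl⟩ := List.mem_map.mp hy
      have : x ^ n ∈ q := Ideal.pow_mem_of_mem _ (hxq x hx) n (Nat.pos_of_ne_zero hn)
      rw [← Localization.AtPrime.under_maximalIdeal (I := q)] at this
      exact this
    · rw [IsLocalization.AtPrime.ringKrullDim_eq_height q S, ← hlen]
      simp [zs, ys]
    · intro 𝔓 h𝔓 hle
      have h1 : 𝔓.comap (algebraMap B S) ≤ q := by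
        exact (Ideal.comap_mono (IsLocalRing.le_maximalIdeal h𝔓.ne_top)).trans
          (le_of_eq Localization.AtPrime.under_maximalIdeal)
      have h2 : Ideal.ofList xs ≤ 𝔓.comap (algebraMap B S) := by
        refine Ideal.span_le.mpr fun x hx => ?_
        have : algebraMap B S (x ^ n) ∈ 𝔓 := hle (Ideal.subset_span (by
          exact List.mem_map_of_mem (List.mem_map_of_mem (f := (· ^ n)) hx)))
        rw [map_pow] at this
        exact h𝔓.mem_of_pow_mem _ this
      have h3 := le_antisymm h1 (hmin.2 ⟨Ideal.IsPrime.comap _, h2⟩ h1)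
      have h2 : (⟨𝔓, inferInstance⟩ : PrimeSpectrum S) = ⟨maximalIdeal S, inferInstance⟩ :=
        PrimeSpectrum.localization_comap_injective S q.primeCompl (by
          ext1
          exact h3.trans Localization.AtPrime.under_maximalIdeal.symm)
      exact congrArg PrimeSpectrum.asIdeal h2
  have hw := (cmfs_wreg_iff zs).mp hreg.toIsWeaklyRegular ⟨i, by simpa [zs, ys] using hi⟩ (algebraMap B S b)
  have he : Ideal.ofList (zs.take i) = (Ideal.ofList (ys.take i)).map (algebraMap B S) := by
    rw [Ideal.map_ofList, List.map_take]
  have hz : zs[i]'(by simpa [zs, ys] using hi) = algebraMap B S (xs[i] ^ n) := by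
    simp [zs, ys]
  have h1 : algebraMap B S b ∈ (Ideal.ofList (ys.take i)).map (algebraMap B S) := by
    rw [← he]
    apply hw
    change zs[i]'(by simpa [zs, ys] using hi) * _ ∈ _
    rw [hz, ← map_mul]
    change _ ∈ Ideal.ofList (zs.take i)
    rw [he]
    exact Ideal.mem_map_of_mem _ hb
  rw [IsLocalization.algebraMap_mem_map_algebraMap_iff q.primeCompl] at h1
  exact h1

theorem cmfs_main {B A R : Type*} [CommRing B] [CommRing A] [CommRing R]
    [Algebra B A] [Algebra A R] [Algebra B R] [IsScalarTower B A R]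
    [IsNoetherianRing A] [IsNoetherianRing R] [IsLocalRing R]
    [Module.Finite B A] [IsDomain B] [IsIntegrallyClosed B] [IsRegularRing B]
    (M : Submonoid A) [IsLocalization M R] (hinj : Function.Injective (algebraMap B R))
    (f : R) (hRf : IsCohenMacaulayRing (Localization.Away f)) (p : ℕ) (hp : p.Prime) [CharP R p]
    (θ : R → R)
    (hθ_add : ∀ a b : R, θ (a + b) = θ a + θ b)
    (hθ_lin : ∀ a b : R, θ (a ^ p * b) = a * θ b)
    (hθ_f : θ f = 1) : IsCohenMacaulayLocalRing R := by
  classical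
  obtain ⟨N, hN⟩ := cmfs_T_pow (B := B) (A := A) f (fun Q hQ hfQ =>
    cmfs_flat M hinj f hRf p hp θ hθ_add hθ_lin hθ_f Q hfQ)
  let q := (maximalIdeal R).comap (algebraMap B R)
  obtain ⟨s, hmin, hcard⟩ := Ideal.exists_finset_card_eq_height_of_isNoetherianRing q
  let xs := s.toList
  have hxs : Ideal.ofList xs = Ideal.span s := by
    simp [xs, Ideal.ofList]
  rw [← hxs] at hmin
  have hlen : (xs.length : ℕ∞) = q.height := by rw [← hcard]; simp [xs]
  have hxq : ∀ x ∈ xs, x ∈ q := fun x hx => hmin.1.2 (Ideal.subset_span hx)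
  let ws := xs.map (algebraMap B R)
  have hwm : ∀ w ∈ ws, w ∈ maximalIdeal R := by
    intro w hw
    obtain ⟨x, hx, rfl⟩ := List.mem_map.mp hw
    exact hxq x hx
  refine ⟨ws, hwm, ?_, ?_⟩
  · refine IsRegular.of_isWeaklyRegular_of_mem_maximalIdeal _ hwm ?_
    rw [cmfs_wreg_iff]
    rintro ⟨i, hi⟩ r hr
    have hi' : i < xs.length := by simpa [ws] using hi
    have : Fact p.Prime := ⟨hp⟩
    refine cmfs_theta_span hθ_add hθ_lin hθ_f N N (cmfs_C_ge p hp N) _ _ ?_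
    have hspan : Ideal.span ((fun x : R => x ^ p ^ N) '' {r | r ∈ ws.take i}) =
        (Ideal.ofList ((xs.map (· ^ p ^ N)).take i)).map (algebraMap B R) := by
      rw [Ideal.map_ofList, Ideal.ofList, List.map_take]
      congr 1
      ext z
      simp only [Set.mem_image, Set.mem_ofPred_eq, ws, List.map_map, ← List.map_take, List.mem_map,
        Function.comp]
      constructor
      · rintro ⟨_, ⟨a, ha, rfl⟩, rfl⟩
        exact ⟨a, ha, by simp⟩
      · rintro ⟨a, ha, rfl⟩
        exact ⟨_, ⟨a, ha, rfl⟩, by simp⟩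
    change _ ∈ Ideal.span ((fun x : R => x ^ p ^ N) '' {r | r ∈ ws.take i})
    rw [hspan]
    refine cmfs_colon M _ (xs[i] ^ p ^ N) ?_ _ ?_ _ hN
    · intro b hb
      exact cmfs_B_colon q xs hmin hlen (p ^ N) (pow_ne_zero _ hp.ne_zero) i hi' b hb
    · rw [← hspan]
      have h1 := Ideal.mem_map_of_mem (iterateFrobenius R p N) hr
      have h2 : (Ideal.ofList (ws.take i)).map (iterateFrobenius R p N) =
        Ideal.span ((fun x : R => x ^ p ^ N) '' {r | r ∈ ws.take i}) := by
        rw [Ideal.ofList, Ideal.map_span]; rfl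
      rw [← h2]
      convert h1 using 1
      simp [iterateFrobenius_def, mul_pow, ws]
  · rw [← IsLocalRing.maximalIdeal_height_eq_ringKrullDim, ← IsLocalization.height_under M (maximalIdeal R)]
    obtain ⟨P, hPm, hle⟩ := Ideal.exists_minimalPrimes_le (I := ⊥) (J := maximalIdeal R) bot_le
    have hP : P.IsPrime := hPm.1.1
    have hPB := cmfs_equidim (B := B) M hinj f hRf p hp θ hθ_add hθ_lin hθ_f P hPm
    have h3 := cmfs_L3 (B := B) ((maximalIdeal R).under A) (P.under A) (Ideal.comap_mono hle) (by
      rw [← hPB, Ideal.under, Ideal.comap_comap, IsScalarTower.algebraMap_eq B A R])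
    rw [h3, Ideal.under, Ideal.comap_comap, ← IsScalarTower.algebraMap_eq B A R]
    change _ = ((q.height : ℕ∞) : WithBot ℕ∞)
    rw [← hlen]
    simp [ws]

end cmfsHelpers

/-- Let `p` be a prime, `k` a field of characteristic `p`, and `(R, m)`
a Noetherian local ring of characteristic `p` which is the localization of a finite type
`k`-algebra at a prime ideal.  Let `f ∈ m` be a nonzerodivisor such that `R_f` is
Cohen-Macaulay, and suppose `R` splits relative to `f` (there is a `p⁻¹`-linear map
`θ : R → R` with `θ f = 1`).  Then `R` is a Cohen-Macaulay local ring. -/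
theorem cohenMacaulay_of_relative_frobenius_split_local
    (p : ℕ) (hp : p.Prime)
    (k : Type*) [Field k] [CharP k p]
    (R : Type*) [CommRing R] [IsLocalRing R] [IsNoetherianRing R] [CharP R p]
    -- `R` is the localization of a finite type `k`-algebra at a prime ideal
    (A : Type*) [CommRing A] [Algebra k A]
    (hA : Algebra.FiniteType k A) (P : Ideal A) (hP : P.IsPrime)
    (e : R ≃+* @Localization.AtPrime A _ P hP)
    -- `f ∈ m` is a nonzerodivisor with `R_f` Cohen-Macaulay
    (f : R) (hfm : f ∈ IsLocalRing.maximalIdeal R) (hf : f ∈ nonZeroDivisors R)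
    (hRf : IsCohenMacaulayRing (Localization.Away f))
    -- `R` splits relative to `f`
    (θ : R → R)
    (hθ_add : ∀ a b : R, θ (a + b) = θ a + θ b)
    (hθ_lin : ∀ a b : R, θ (a ^ p * b) = a * θ b)
    (hθ_f : θ f = 1) :
    IsCohenMacaulayLocalRing R := by
  let φ : A →+* R := e.symm.toRingHom.comp (algebraMap A (Localization.AtPrime P))
  let _ : Algebra k R := (φ.comp (algebraMap k A)).toAlgebra
  let ψ : A →ₐ[k] R := { φ with commutes' := fun _ => rfl }
  let A0 := ψ.range
  have hft : Algebra.FiniteType k A0 := Algebra.FiniteType.of_surjective ψ.rangeRestrict ψ.rangeRestrict_surjective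
  have hnoeth : IsNoetherianRing A0 := Algebra.FiniteType.isNoetherianRing k A0
  let M : Submonoid A0 := P.primeCompl.map ψ.rangeRestrict
  have hloc : IsLocalization M R := by
    refine ⟨?_, ?_, ?_⟩
    · rintro ⟨_, ⟨s, hs, rfl⟩⟩
      change IsUnit (e.symm (algebraMap A (Localization.AtPrime P) s))
      exact (IsLocalization.map_units (Localization.AtPrime P) (⟨s, hs⟩ : P.primeCompl)).map e.symm
    · intro z
      obtain ⟨⟨x, s⟩, hs⟩ := IsLocalization.surj P.primeCompl (e z)
      refine ⟨⟨ψ.rangeRestrict x, ⟨ψ.rangeRestrict s, ⟨s, s.2, rfl⟩⟩⟩, ?_⟩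
      change z * e.symm (algebraMap A (Localization.AtPrime P) s) = e.symm (algebraMap A (Localization.AtPrime P) x)
      apply e.injective
      rw [map_mul, e.apply_symm_apply, e.apply_symm_apply]
      exact hs
    · intro x y hxy
      exact ⟨1, by rw [Subtype.ext hxy]⟩
  obtain ⟨s, g, hginj, hgfin⟩ := exists_finite_inj_algHom_of_fg k A0
  let B := MvPolynomial (Fin s) k
  let _ : Algebra B A0 := g.toRingHom.toAlgebra
  let _ : Algebra B R := ((algebraMap A0 R).comp (algebraMap B A0)).toAlgebra
  have : IsScalarTower B A0 R := IsScalarTower.of_algebraMap_eq fun _ => rfl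
  have : Module.Finite B A0 := hgfin
  have : IsRegularRing B := MvPolynomial.isRegularRing_of_isRegularRing _
  refine cmfs_main (B := B) (A := A0) M ?_ f hRf p hp θ hθ_add hθ_lin hθ_f
  exact (Subtype.val_injective : Function.Injective (algebraMap A0 R)).comp hginj
end
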